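/- arXiv:2201.04564 — 3 statements merged into one kernel-verified Lean document; each statement's English description precedes it below -/
import Mathlib

section
/- Let k: ℤ → [0,∞) be a nontrivial kernel with k(0)=0, k(−j)=k(j) for all j ∈ ℤ, and ∑_{j∈ℤ} k(j) < ∞. Let α ∈ (1,2] and γ = α/(α−1). Assume: (a) C_α(k) := ∑_{j∈ℕ} k(j) j^α < ∞; (b) k is non-increasing on ℕ, i.e. k(j) ≥ k(j+1) for all j ∈ ℕ; (c) there is a constant C ≥ 1 with k(j) ≤ C·k(j+1) for all j ∈ ℕ. Then there exists a constant d > 0 such that for every bounded function u: ℤ → ℝ and every x ∈ ℤ one has Ψ_{2,Υ}(u)(x) ≥ (1/d)·|Lu(x)|^γ. -/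
open scoped BigOperators
open Filter Set

noncomputable section

/-- `Υ(r) = e^r − 1 − r`. -/
def Ups (r : ℝ) : ℝ := Real.exp r - 1 - r

/-- `H(x) = (1/2) e^{−x} Υ(2x)`. -/
def Hfun (x : ℝ) : ℝ := (1 / 2) * Real.exp (-x) * Ups (2 * x)

/-- The long-range jump operator `L u (x) = ∑_{j∈ℤ} k(j)(u(x+j) − u(x))`. -/
def Lop (k : ℤ → ℝ) (u : ℤ → ℝ) (x : ℤ) : ℝ := ∑' j : ℤ, k j * (u (x + j) - u x)

/-- `Ψ_Υ(u)(x) = ∑_{j∈ℤ} k(j) Υ(u(x+j) − u(x))`. -/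
def PsiUps (k : ℤ → ℝ) (u : ℤ → ℝ) (x : ℤ) : ℝ := ∑' j : ℤ, k j * Ups (u (x + j) - u x)

/-- `Ψ_{2,Υ}(u)(x)`. -/
def Psi2 (k : ℤ → ℝ) (u : ℤ → ℝ) (x : ℤ) : ℝ :=
  (1 / 2) * ∑' p : ℤ × ℤ, k p.1 * k p.2 * Real.exp (u (x + p.2) - u x) *
    Ups (u (x + p.1 + p.2) - u (x + p.1) - u (x + p.2) + u x)

/-- A bounded function on `ℤ`. -/
def BddFun (u : ℤ → ℝ) : Prop := ∃ M : ℝ, ∀ x : ℤ, |u x| ≤ M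

/-- A nontrivial symmetric integrable kernel on `ℤ` vanishing at `0`. -/
structure IsKernel (k : ℤ → ℝ) : Prop where
  nonneg : ∀ j, 0 ≤ k j
  zero_at_zero : k 0 = 0
  symm : ∀ j, k (-j) = k j
  summable : Summable k
  nontrivial : ∃ j, k j ≠ 0

/-- A CD-function: continuous on `[0,∞)`, nonnegative, `F(0)=0`, `r ↦ F(r)/r` strictly
increasing on `(0,∞)` and `1/F` integrable at `∞`. -/
def IsCDFunction (F : ℝ → ℝ) : Prop :=
  ContinuousOn F (Ici 0) ∧ (∀ r, 0 ≤ r → 0 ≤ F r) ∧ F 0 = 0 ∧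
    StrictMonoOn (fun r => F r / r) (Ioi 0) ∧
    ∃ a, 0 < a ∧ MeasureTheory.IntegrableOn (fun r => 1 / F r) (Ici a)

/-- The curvature-dimension condition `CD_Υ(0,F)` for the operator generated by `k`. -/
def CDUps (k : ℤ → ℝ) (F : ℝ → ℝ) : Prop :=
  ∀ u : ℤ → ℝ, BddFun u → ∀ x : ℤ, 0 ≤ -Lop k u x → F (-Lop k u x) ≤ Psi2 k u x

lemma Ups_nonneg (r : ℝ) : 0 ≤ Ups r := by
  unfold Ups; linarith [Real.add_one_le_exp r]

lemma Ups_ge_sq (r : ℝ) : (Real.exp (r/2) - 1)^2 ≤ Ups r := by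
  have h := Real.add_one_le_exp (r/2)
  have e : Real.exp r = Real.exp (r/2) * Real.exp (r/2) := by rw [← Real.exp_add]; ring_nf
  unfold Ups; rw [e]; nlinarith

lemma Ups_lower (r : ℝ) : r^2 / 64 * Real.exp (r/2 + |r|/4) ≤ Ups r := by
  refine le_trans ?_ (Ups_ge_sq r)
  rcases le_total 0 r with h | h
  · rw [abs_of_nonneg h]
    set q := Real.exp (r/8) with hq
    have h1 : r/8 + 1 ≤ q := Real.add_one_le_exp (r/8)
    have e1 : Real.exp (r/2 + r/4) = (q^3)^2 := by
      rw [hq, ← Real.exp_nat_mul, ← Real.exp_nat_mul]; congr 1; push_cast; ring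
    have e2 : Real.exp (r/2) = q^4 := by
      rw [hq, ← Real.exp_nat_mul]; congr 1; push_cast; ring
    rw [e1, e2]
    have : r/8 * q^3 ≤ q^4 - 1 := by
      have hq1 : 1 ≤ q := by linarith
      have h3 : 1 ≤ q^3 := one_le_pow₀ hq1
      nlinarith
    have h0 : 0 ≤ r/8 * q^3 := by positivity
    calc r^2/64 * (q^3)^2 = (r/8*q^3)^2 := by ring
      _ ≤ _ := by gcongr
  · rw [abs_of_nonpos h]
    set q := Real.exp (r/8) with hq
    have h1 : -(r/8) + 1 ≤ Real.exp (-(r/8)) := Real.add_one_le_exp (-(r/8))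
    have hq0 : 0 < q := Real.exp_pos _
    have hq1 : q ≤ 1 := Real.exp_le_one_iff.2 (by linarith)
    rw [Real.exp_neg, ← hq] at h1
    have h2 : (-(r/8) + 1) * q ≤ 1 := by
      have := mul_le_mul_of_nonneg_right h1 hq0.le
      rwa [inv_mul_cancel₀ hq0.ne'] at this
    have e1 : Real.exp (r/2 + -r/4) = q^2 := by
      rw [hq, ← Real.exp_nat_mul]; congr 1; push_cast; ring
    have e2 : Real.exp (r/2) = q^4 := by
      rw [hq, ← Real.exp_nat_mul]; congr 1; push_cast; ring
    rw [e1, e2]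
    have h4 : q^4 ≤ q := pow_le_of_le_one hq0.le hq1 (by norm_num)
    have h0 : 0 ≤ -(r/8) * q := mul_nonneg (by linarith) hq0.le
    calc r^2/64 * q^2 = (-(r/8)*q)^2 := by ring
      _ ≤ (1 - q^4)^2 := by gcongr; linarith
      _ = _ := by ring

lemma pow_exp (γ : ℝ) (hγ : 2 ≤ γ) : ∃ K : ℝ, 0 < K ∧ ∀ t : ℝ, 0 ≤ t →
    t ^ γ ≤ K * (t^2 * Real.exp (t/16)) := by
  obtain ⟨m, hm⟩ := exists_nat_ge (γ - 2)
  refine ⟨1 + m.factorial * 16^m, by positivity, fun t ht => ?_⟩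
  rcases le_total t 1 with h | h
  · have h1 : t ^ γ ≤ t^2 := by
      rcases ht.eq_or_lt with h0 | h0
      · rw [← h0, Real.zero_rpow (by linarith)]; norm_num
      · rw [← Real.rpow_natCast]; exact Real.rpow_le_rpow_of_exponent_ge h0 h (by exact_mod_cast hγ)
    have h2 : 1 ≤ Real.exp (t/16) := Real.one_le_exp (by positivity)
    have h3 : t^2 ≤ t^2 * Real.exp (t/16) := le_mul_of_one_le_right (by positivity) h2
    have : (0:ℝ) ≤ m.factorial * 16^m * (t^2 * Real.exp (t/16)) := by positivity
    nlinarith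
  · have h1 : t ^ γ ≤ t^2 * t^m := by
      rw [← pow_add, ← Real.rpow_natCast]
      exact Real.rpow_le_rpow_of_exponent_le h (by push_cast; linarith)
    have h2 := Real.pow_div_factorial_le_exp (t/16) (by positivity) m
    have h3 : t^m ≤ m.factorial * 16^m * Real.exp (t/16) := by
      rw [div_pow, div_div, div_le_iff₀ (by positivity)] at h2
      linarith
    have h4 : t^2 * t^m ≤ t^2 * (m.factorial * 16^m * Real.exp (t/16)) := by gcongr
    have : (0:ℝ) ≤ (t^2 * Real.exp (t/16)) := by positivity
    nlinarith

lemma scalar_s (γ K : ℝ) (hK : 0 < K) (hKt : ∀ t : ℝ, 0 ≤ t → t ^ γ ≤ K * (t^2 * Real.exp (t/16)))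
    (a b : ℝ) : |a+b|^γ ≤ 64 * K * ((Real.exp a + Real.exp b) * Ups (-(a+b))) := by
  have h1 := hKt _ (abs_nonneg (a+b))
  have h2 := Ups_lower (-(a+b))
  rw [abs_neg] at h2
  have h3 : Real.exp ((a+b)/2) ≤ Real.exp a + Real.exp b := by
    rcases le_total a b with h | h
    · have := Real.exp_le_exp.2 (show (a+b)/2 ≤ b by linarith); have := Real.exp_pos a; linarith
    · have := Real.exp_le_exp.2 (show (a+b)/2 ≤ a by linarith); have := Real.exp_pos b; linarith
  have h4 : Real.exp ((a+b)/2) * ((-(a+b))^2/64 * Real.exp (-(a+b)/2 + |a+b|/4)) ≤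
     (Real.exp a + Real.exp b) * Ups (-(a+b)) := by gcongr
  have h5 : Real.exp ((a+b)/2) * ((-(a+b))^2/64 * Real.exp (-(a+b)/2 + |a+b|/4)) =
     |a+b|^2/64 * Real.exp (|a+b|/4) := by
    rw [sq_abs, show |a+b|/4 = (a+b)/2 + (-(a+b)/2 + |a+b|/4) by ring, Real.exp_add ((a+b)/2)]
    ring_nf
  have h6 : |a+b|^2/64 * Real.exp (|a+b|/16) ≤ |a+b|^2/64 * Real.exp (|a+b|/4) := by
    gcongr; norm_num
  calc _ ≤ _ := h1
    _ = 64 * K * (|a+b|^2/64 * Real.exp (|a+b|/16)) := by ring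
    _ ≤ _ := mul_le_mul_of_nonneg_left (by linarith) (by positivity)

lemma scalar_w (γ K : ℝ) (hγ : 2 ≤ γ) (hK : 0 < K)
    (hKt : ∀ t : ℝ, 0 ≤ t → t ^ γ ≤ K * (t^2 * Real.exp (t/16)))
    (a b w : ℝ) : |w|^γ ≤ 128 * K * 4 ^ γ * (Real.exp a * Ups w + Real.exp b * Ups (-w-(a+b)) +
      (Real.exp a + Real.exp b) * Ups (-(a+b))) := by
  have hs := scalar_s γ K hK hKt a b
  have p1 := mul_nonneg (Real.exp_pos a).le (Ups_nonneg w)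
  have p2 := mul_nonneg (Real.exp_pos b).le (Ups_nonneg (-w-(a+b)))
  have p3 := mul_nonneg (add_pos (Real.exp_pos a) (Real.exp_pos b)).le (Ups_nonneg (-(a+b)))
  have p4 : (1:ℝ) ≤ 4^γ := Real.one_le_rpow (by norm_num) (by linarith)
  rcases le_total |w| (4 * |a+b|) with h | h
  · calc |w|^γ ≤ (4*|a+b|)^γ := by gcongr
      _ = 4^γ * |a+b|^γ := by rw [Real.mul_rpow (by norm_num) (abs_nonneg _)]
      _ ≤ 4^γ * (64 * K * ((Real.exp a + Real.exp b) * Ups (-(a+b)))) := by gcongr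
      _ = 64 * K * 4^γ * ((Real.exp a + Real.exp b) * Ups (-(a+b))) := by ring
      _ ≤ 128 * K * 4 ^ γ * (Real.exp a * Ups w + Real.exp b * Ups (-w-(a+b)) +
      (Real.exp a + Real.exp b) * Ups (-(a+b))) := by gcongr <;> linarith
  · have h1 := hKt _ (abs_nonneg w)
    have hw := Ups_lower w
    have hw' := Ups_lower (-w-(a+b))
    have e : |-w-(a+b)| = |w+(a+b)| := by rw [← abs_neg]; ring_nf
    rw [e] at hw'
    have t1 : 3/4*|w| ≤ |w+(a+b)| := by
      have := abs_sub_abs_le_abs_sub w (-(a+b))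
      rw [abs_neg, sub_neg_eq_add] at this; linarith
    have t2 : 1/2 * w^2 ≤ (-w-(a+b))^2 := by
      have : (3/4*|w|)^2 ≤ |w+(a+b)|^2 := by gcongr
      rw [mul_pow, sq_abs, sq_abs] at this
      nlinarith [sq_nonneg w]
    have key : w^2/128 * Real.exp (|w|/16) ≤ Real.exp a * Ups w + Real.exp b * Ups (-w-(a+b)) := by
      have hab := neg_abs_le (a+b)
      have hw0 := abs_nonneg w
      rcases le_total (|w|/16) (a + (w/2+|w|/4)) with g | g
      · have := mul_le_mul_of_nonneg_left hw (Real.exp_pos a).le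
        have e2 : Real.exp a * (w^2/64 * Real.exp (w/2+|w|/4)) =
          w^2/64 * Real.exp (a + (w/2+|w|/4)) := by rw [Real.exp_add a]; ring
        have : w^2/128 * Real.exp (|w|/16) ≤ w^2/64 * Real.exp (a + (w/2+|w|/4)) := by
          gcongr; norm_num
        linarith
      · have := mul_le_mul_of_nonneg_left hw' (Real.exp_pos b).le
        have g' : |w|/16 ≤ b + ((-w-(a+b))/2+|w+(a+b)|/4) := by linarith
        have e2 : Real.exp b * ((-w-(a+b))^2/64 * Real.exp ((-w-(a+b))/2+|w+(a+b)|/4)) =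
          (-w-(a+b))^2/64 * Real.exp (b + ((-w-(a+b))/2+|w+(a+b)|/4)) := by
            rw [Real.exp_add b]; ring
        have : w^2/128 * Real.exp (|w|/16) ≤
            (-w-(a+b))^2/64 * Real.exp (b + ((-w-(a+b))/2+|w+(a+b)|/4)) := by
          gcongr ?_ * ?_
          · linarith
          · exact Real.exp_le_exp.2 g'
        linarith
    calc |w|^γ ≤ _ := h1
      _ = 128 * K * 1 * (w^2/128 * Real.exp (|w|/16)) := by rw [sq_abs]; ring
      _ ≤ _ := by gcongr; linarith

lemma sum_inv_sqrt' (n : ℕ) : ∑ i ∈ Finset.Ico 1 (n+1), (i:ℝ)^(-(1/2):ℝ) ≤ 2 * (n:ℝ)^(1/2:ℝ) := by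
  induction n with
  | zero => simp
  | succ n ih =>
    rw [Finset.sum_Ico_succ_top (by omega)]
    have e : ((n+1:ℕ):ℝ)^(-(1/2):ℝ) = (√((n+1:ℕ):ℝ))⁻¹ := by
      rw [Real.rpow_neg (by positivity), ← Real.sqrt_eq_rpow]
    rw [e]
    rw [← Real.sqrt_eq_rpow] at *
    have h1 : 0 < √((n+1:ℕ):ℝ) := Real.sqrt_pos.2 (by positivity)
    have h2 : √((n+1:ℕ):ℝ)^2 = n + 1 := by rw [Real.sq_sqrt (by positivity)]; push_cast; ring
    have h3 : √(n:ℝ)^2 = n := by rw [Real.sq_sqrt (by positivity)]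
    have h4 : (√((n+1:ℕ):ℝ))⁻¹ ≤ 2 * √((n+1:ℕ):ℝ) - 2 * √(n:ℝ) := by
      rw [inv_le_iff_one_le_mul₀ h1]
      nlinarith [sq_nonneg (√((n+1:ℕ):ℝ) - √(n:ℝ))]
    linarith

lemma sum_inv_sqrt (n : ℕ) : ∑ i ∈ Finset.Ico 1 n, (i:ℝ)^(-(1/2):ℝ) ≤ 2 * (n:ℝ)^(1/2:ℝ) := by
  rcases n with _ | n
  · simp
  · refine (sum_inv_sqrt' n).trans ?_
    gcongr; simp

lemma sum_inv_sqrt3 (i N : ℕ) (hi : 1 ≤ i) :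
    ∑ n ∈ Finset.Ico (i+1) N, (n:ℝ)^(-(3/2):ℝ) ≤ 2 * (i:ℝ)^(-(1/2):ℝ) := by
  have key : ∀ m : ℕ, ∑ n ∈ Finset.Ico (i+1) (i+1+m), (n:ℝ)^(-(3/2):ℝ) ≤
      2 * (i:ℝ)^(-(1/2):ℝ) - 2 * ((i+m:ℕ):ℝ)^(-(1/2):ℝ) := by
    intro m
    induction m with
    | zero => simp
    | succ m ih =>
      rw [← add_assoc, Finset.sum_Ico_succ_top (by omega)]
      have hn : (0:ℝ) < ((i+m:ℕ):ℝ) := by exact_mod_cast (by omega)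
      have c1 : (i+1+m) = (i+m)+1 := by ring
      have c2 : i + 1 + m = i + m + 1 := c1
      rw [c2] at ih ⊢
      rw [← add_assoc]
      generalize i + m = n at *
      have e : ∀ x : ℝ, 0 < x → x^(-(1/2):ℝ) = (√x)⁻¹ := fun x hx => by
        rw [Real.rpow_neg hx.le, ← Real.sqrt_eq_rpow]
      have e3 : ((n+1:ℕ):ℝ)^(-(3/2):ℝ) = (√((n+1:ℕ):ℝ))⁻¹^3 := by
        rw [← e _ (by positivity), ← Real.rpow_natCast, ← Real.rpow_mul (by positivity)]
        norm_num
      rw [e3, e _ (show (0:ℝ) < ((n+1:ℕ):ℝ) by positivity)]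
      rw [e _ hn] at ih
      set A := √(n:ℝ)
      set B := √((n+1:ℕ):ℝ)
      have hA : 0 < A := Real.sqrt_pos.2 hn
      have hB : 0 < B := Real.sqrt_pos.2 (by positivity)
      have h2 : B^2 = n + 1 := by rw [Real.sq_sqrt (by positivity)]; push_cast; ring
      have h3 : A^2 = n := by rw [Real.sq_sqrt (by positivity)]
      have hAB : A ≤ B := Real.sqrt_le_sqrt (by push_cast; linarith)
      have h4 : B⁻¹^3 ≤ 2 * A⁻¹ - 2 * B⁻¹ := by
        have : 2 * A⁻¹ - 2 * B⁻¹ - B⁻¹^3 = (2 * B^2 * (B - A) - A) / (A * B^3) := by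
          field_simp
        have h5 : 0 ≤ 2 * B^2 * (B - A) - A := by
          have h6 : (B - A) * (B + A) = 1 := by nlinarith
          have h7 : 1 ≤ (B-A) * (2 * B) := by nlinarith
          nlinarith
        have : 0 ≤ (2 * B^2 * (B - A) - A) / (A * B^3) := by positivity
        linarith
      linarith
  rcases le_total N (i+1) with h | h
  · rw [Finset.Ico_eq_empty_of_le h]; simp; positivity
  · obtain ⟨m, rfl⟩ := Nat.exists_eq_add_of_le h
    refine (key m).trans ?_
    have : (0:ℝ) ≤ ((i+m:ℕ):ℝ)^(-(1/2):ℝ) := by positivity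
    linarith

lemma hardy (κ z : ℕ → ℝ) (α γ : ℝ) (hα1 : 1 < α) (hα2 : α ≤ 2) (hγ : γ = α / (α - 1))
    (hκ : ∀ n, 0 ≤ κ n) (hz : ∀ n, 0 ≤ z n)
    (hanti : ∀ i n, 1 ≤ i → i ≤ n → κ n ≤ κ i) (N : ℕ) (M : ℝ)
    (hM : ∑ n ∈ Finset.range N, κ n * (n:ℝ)^α ≤ M) :
    (∑ n ∈ Finset.range N, κ n * ∑ i ∈ Finset.Ico 1 n, z i) ^ γ ≤
      (2 * M)^(γ-1) * (2 * ∑ i ∈ Finset.Ico 1 N, κ i * z i ^ γ) := by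
  have ha : 0 < α - 1 := by linarith
  have hγ1 : 1 < γ := by rw [hγ, lt_div_iff₀ ha]; linarith
  set θ := (α - 1)/2 with hθ
  have hθγ : θ * (1 - γ) = -(1/2) := by rw [hγ, hθ]; field_simp; ring
  let s : Finset (Σ _ : ℕ, ℕ) := (Finset.range N).sigma (fun n => Finset.Ico 1 n)
  let W : (Σ _ : ℕ, ℕ) → ℝ := fun p => κ p.1 * ((p.1:ℝ)^(3*θ) * (p.2:ℝ)^(-θ))
  let F : (Σ _ : ℕ, ℕ) → ℝ := fun p => z p.2 * ((p.1:ℝ)^(3*θ) * (p.2:ℝ)^(-θ))⁻¹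
  have hW : ∀ p, 0 ≤ W p := fun p => mul_nonneg (hκ _) (by positivity)
  have hF : ∀ p, 0 ≤ F p := fun p => mul_nonneg (hz _) (by positivity)
  have hol := Real.inner_le_weight_mul_Lp_of_nonneg s hγ1.le W F hW hF
  have hmem : ∀ p ∈ s, 1 ≤ p.2 ∧ p.2 < p.1 ∧ p.1 < N := by
    intro p hp
    simp only [s, Finset.mem_sigma, Finset.mem_range, Finset.mem_Ico] at hp
    omega
  have e1 : ∑ p ∈ s, W p * F p = ∑ n ∈ Finset.range N, κ n * ∑ i ∈ Finset.Ico 1 n, z i := by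
    simp_rw [Finset.mul_sum]
    rw [Finset.sum_sigma']
    refine Finset.sum_congr rfl fun p hp => ?_
    obtain ⟨h1, h2, h3⟩ := hmem p hp
    have c1 : (0:ℝ) < p.1 := by exact_mod_cast (by omega)
    have c2 : (0:ℝ) < p.2 := by exact_mod_cast (by omega)
    have : (0:ℝ) < ((p.1:ℝ)^(3*θ) * (p.2:ℝ)^(-θ)) := by positivity
    simp only [W, F]; field_simp
  have e2 : ∑ p ∈ s, W p ≤ 2 * M := by
    have : ∑ p ∈ s, W p ≤ ∑ n ∈ Finset.range N, 2 * (κ n * (n:ℝ)^α) := by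
      simp only [s]
      rw [Finset.sum_sigma]
      refine Finset.sum_le_sum fun n hn => ?_
      simp only [W]
      rw [← Finset.mul_sum, ← Finset.mul_sum]
      rcases Nat.eq_zero_or_pos n with h0 | h0
      · subst h0; simp; exact mul_nonneg (hκ _) (by positivity)
      have hn0 : (0:ℝ) < n := by exact_mod_cast h0
      have g : ∑ i ∈ Finset.Ico 1 n, (i:ℝ)^(-θ) ≤ (n:ℝ)^(1/2-θ) * (2 * (n:ℝ)^(1/2:ℝ)) := by
        calc _ ≤ ∑ i ∈ Finset.Ico 1 n, (n:ℝ)^(1/2-θ) * (i:ℝ)^(-(1/2):ℝ) := by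
              refine Finset.sum_le_sum fun i hi => ?_
              rw [Finset.mem_Ico] at hi
              have hi0 : (0:ℝ) < i := by exact_mod_cast (by omega)
              have : (i:ℝ)^(-θ) = (i:ℝ)^(1/2-θ) * (i:ℝ)^(-(1/2):ℝ) := by
                rw [← Real.rpow_add hi0]; congr 1; ring
              rw [this]
              gcongr
              · rw [hθ]; linarith
              · omega
          _ ≤ _ := by
              rw [← Finset.mul_sum]
              gcongr
              exact sum_inv_sqrt n
      calc κ n * ((n:ℝ)^(3*θ) * ∑ i ∈ Finset.Ico 1 n, (i:ℝ)^(-θ))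
          ≤ κ n * ((n:ℝ)^(3*θ) * ((n:ℝ)^(1/2-θ) * (2 * (n:ℝ)^(1/2:ℝ)))) := by
            have := hκ n
            gcongr
        _ = 2 * (κ n * ((n:ℝ)^(3*θ) * (n:ℝ)^(1/2-θ) * (n:ℝ)^(1/2:ℝ))) := by ring
        _ = 2 * (κ n * (n:ℝ)^α) := by
            rw [← Real.rpow_add hn0, ← Real.rpow_add hn0]
            congr 3; rw [hθ]; ring
    rw [← Finset.mul_sum] at this
    linarith
  have e3 : ∑ p ∈ s, W p * F p ^ γ ≤ 2 * ∑ i ∈ Finset.Ico 1 N, κ i * z i ^ γ := by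
    have t1 : ∀ p ∈ s, W p * F p ^ γ ≤
        κ p.2 * z p.2 ^ γ * ((p.2:ℝ)^(1/2:ℝ) * (p.1:ℝ)^(-(3/2):ℝ)) := by
      intro p hp
      obtain ⟨h1, h2, h3⟩ := hmem p hp
      have c1 : (0:ℝ) < p.1 := by exact_mod_cast (by omega)
      have c2 : (0:ℝ) < p.2 := by exact_mod_cast (by omega)
      have c3 : (0:ℝ) < ((p.1:ℝ)^(3*θ) * (p.2:ℝ)^(-θ)) := by positivity
      have q : ((p.1:ℝ)^(3*θ) * (p.2:ℝ)^(-θ)) * (((p.1:ℝ)^(3*θ) * (p.2:ℝ)^(-θ))⁻¹)^γ =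
          ((p.2:ℝ)^(1/2:ℝ) * (p.1:ℝ)^(-(3/2):ℝ)) := by
        rw [Real.inv_rpow c3.le, ← Real.rpow_neg c3.le]
        nth_rewrite 1 [← Real.rpow_one ((p.1:ℝ)^(3*θ) * (p.2:ℝ)^(-θ))]
        rw [← Real.rpow_add c3, Real.mul_rpow (by positivity) (by positivity),
          ← Real.rpow_mul c1.le, ← Real.rpow_mul c2.le, mul_comm]
        congr 2
        · linarith
        · linarith
      have : W p * F p ^ γ = κ p.1 * z p.2 ^ γ * ((p.2:ℝ)^(1/2:ℝ) * (p.1:ℝ)^(-(3/2):ℝ)) := by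
        simp only [W, F]
        rw [Real.mul_rpow (hz _) (by positivity), ← q]; ring
      rw [this]
      have := hanti p.2 p.1 h1 h2.le
      have := Real.rpow_nonneg (hz p.2) γ
      gcongr
    refine (Finset.sum_le_sum t1).trans ?_
    simp only [s]
    rw [Finset.sum_sigma, Finset.sum_comm' (t' := Finset.Ico 1 N) (s' := fun i => Finset.Ico (i+1) N)
      (by intro x y; simp only [Finset.mem_range, Finset.mem_Ico]; omega), Finset.mul_sum]
    refine Finset.sum_le_sum fun i hi => ?_
    rw [Finset.mem_Ico] at hi
    have hi0 : (0:ℝ) < i := by exact_mod_cast (by omega)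
    dsimp only
    rw [← Finset.mul_sum, ← Finset.mul_sum]
    have h1 : 0 ≤ κ i * z i ^ γ := mul_nonneg (hκ _) (Real.rpow_nonneg (hz _) _)
    have h2 : (i:ℝ)^(1/2:ℝ) * ∑ n ∈ Finset.Ico (i+1) N, (n:ℝ)^(-(3/2):ℝ) ≤ 2 := by
      calc _ ≤ (i:ℝ)^(1/2:ℝ) * (2 * (i:ℝ)^(-(1/2):ℝ)) := by
            gcongr; exact sum_inv_sqrt3 i N hi.1
        _ = 2 * ((i:ℝ)^(1/2:ℝ) * (i:ℝ)^(-(1/2):ℝ)) := by ring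
        _ = 2 := by rw [← Real.rpow_add hi0]; norm_num
    calc _ ≤ κ i * z i ^ γ * 2 := by gcongr
      _ = _ := by ring
  rw [e1] at hol
  have hW0 : 0 ≤ ∑ p ∈ s, W p := Finset.sum_nonneg fun p _ => hW p
  have hF0 : 0 ≤ ∑ p ∈ s, W p * F p ^ γ :=
    Finset.sum_nonneg fun p _ => mul_nonneg (hW p) (Real.rpow_nonneg (hF p) _)
  have hL0 : 0 ≤ ∑ n ∈ Finset.range N, κ n * ∑ i ∈ Finset.Ico 1 n, z i :=
    Finset.sum_nonneg fun n _ => mul_nonneg (hκ _) (Finset.sum_nonneg fun i _ => hz i)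
  have hg : γ ≠ 0 := by linarith
  calc _ ≤ ((∑ p ∈ s, W p)^(1-γ⁻¹) * (∑ p ∈ s, W p * F p ^ γ)^γ⁻¹)^γ := by
        gcongr
    _ = (∑ p ∈ s, W p)^(γ-1) * (∑ p ∈ s, W p * F p ^ γ) := by
        rw [Real.mul_rpow (by positivity) (by positivity), ← Real.rpow_mul hW0, ← Real.rpow_mul hF0]
        congr 1
        · congr 1; field_simp
        · rw [inv_mul_cancel₀ hg, Real.rpow_one]
    _ ≤ _ := by
        have hM0 : 0 ≤ 2 * M := hW0.trans e2
        gcongr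
/-- The (j,l) summand. -/
def TT (k f : ℤ → ℝ) (p : ℤ × ℤ) : ℝ :=
  k p.1 * k p.2 * Real.exp (f p.2) * Ups (f (p.1 + p.2) - f p.1 - f p.2)

lemma TT_nonneg (k f : ℤ → ℝ) (hk : ∀ j, 0 ≤ k j) (p : ℤ × ℤ) : 0 ≤ TT k f p :=
  mul_nonneg (mul_nonneg (mul_nonneg (hk _) (hk _)) (Real.exp_pos _).le) (Ups_nonneg _)

lemma TT_summable (k f : ℤ → ℝ) (hk : ∀ j, 0 ≤ k j) (hs : Summable k) (B : ℝ)
    (hf : ∀ j, |f j| ≤ B) : Summable (TT k f) := by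
  have h := Summable.mul_of_nonneg hs hs hk hk
  have h' := h.mul_right (Real.exp B * (Real.exp (3 * B) + 3 * B))
  refine Summable.of_nonneg_of_le (TT_nonneg k f hk) (fun p => ?_) h'
  have h1 := abs_le.1 (hf p.2)
  have h2 := abs_le.1 (hf p.1)
  have h3 := abs_le.1 (hf (p.1 + p.2))
  have g1 : Real.exp (f p.2) ≤ Real.exp B := Real.exp_le_exp.2 h1.2
  have g2 : Ups (f (p.1 + p.2) - f p.1 - f p.2) ≤ Real.exp (3 * B) + 3 * B := by
    have : Real.exp (f (p.1 + p.2) - f p.1 - f p.2) ≤ Real.exp (3 * B) :=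
      Real.exp_le_exp.2 (by linarith)
    unfold Ups; linarith
  have := mul_nonneg (hk p.1) (hk p.2)
  have := Ups_nonneg (f (p.1 + p.2) - f p.1 - f p.2)
  unfold TT
  rw [mul_assoc (k p.1 * k p.2)]
  gcongr

lemma TT_sum_le (k f : ℤ → ℝ) (hk : ∀ j, 0 ≤ k j) (hT : Summable (TT k f))
    (e : ℕ → ℤ × ℤ) (he : Function.Injective e) (s : Finset ℕ) :
    ∑ i ∈ s, TT k f (e i) ≤ ∑' p, TT k f p := by
  have := Summable.sum_le_tsum (s.map ⟨e, he⟩) (fun i _ => TT_nonneg k f hk i) hT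
  rwa [Finset.sum_map] at this

/-- one side of the estimate -/
lemma side (κ w P Q : ℕ → ℝ) (γ c a b k1 C S Ks : ℝ) (N : ℕ)
    (hκ : ∀ n, 0 ≤ κ n) (hc : 0 < c) (hk1 : 0 < k1) (hC : 1 ≤ C)
    (hw : ∀ w : ℝ, |w|^γ ≤ c * (Real.exp a * Ups w + Real.exp b * Ups (-w-(a+b)) +
      (Real.exp a + Real.exp b) * Ups (-(a+b))))
    (hP : ∀ n, 1 ≤ n → κ n * (k1 * (Real.exp a * Ups (w n))) ≤ C * P n)
    (hQ : ∀ n, 1 ≤ n → κ n * (k1 * (Real.exp b * Ups (-w n - (a+b)))) ≤ C * Q n)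
    (hPS : ∑ n ∈ Finset.Ico 1 N, P n ≤ S) (hQS : ∑ n ∈ Finset.Ico 1 N, Q n ≤ S)
    (hS : 0 ≤ S)
    (hG : k1 * k1 * ((Real.exp a + Real.exp b) * Ups (-(a+b))) ≤ 2 * S)
    (hKs : ∑ n ∈ Finset.Ico 1 N, κ n ≤ Ks) :
    ∑ n ∈ Finset.Ico 1 N, κ n * |w n|^γ ≤ c * (2 * C / k1 + 2 * Ks / (k1 * k1)) * S := by
  set G := (Real.exp a + Real.exp b) * Ups (-(a+b)) with hGd
  have hG0 : 0 ≤ G := mul_nonneg (by positivity) (Ups_nonneg _)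
  have hKs0 : 0 ≤ Ks := le_trans (Finset.sum_nonneg fun n _ => hκ n) hKs
  have t : ∀ n ∈ Finset.Ico 1 N, κ n * |w n|^γ ≤ c * (C / k1 * P n + C / k1 * Q n + κ n * G) := by
    intro n hn
    have h1 := (Finset.mem_Ico.1 hn).1
    have a1 : κ n * (Real.exp a * Ups (w n)) ≤ C / k1 * P n := by
      rw [div_mul_eq_mul_div, le_div_iff₀ hk1]; linarith [hP n h1]
    have a2 : κ n * (Real.exp b * Ups (-w n - (a+b))) ≤ C / k1 * Q n := by
      rw [div_mul_eq_mul_div, le_div_iff₀ hk1]; linarith [hQ n h1]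
    calc κ n * |w n|^γ ≤ κ n * (c * (Real.exp a * Ups (w n) + Real.exp b * Ups (-w n-(a+b)) + G)) :=
          mul_le_mul_of_nonneg_left (hw _) (hκ n)
      _ = c * (κ n * (Real.exp a * Ups (w n)) + κ n * (Real.exp b * Ups (-w n-(a+b))) + κ n * G) := by
          ring
      _ ≤ _ := by gcongr
  have hG1 : G ≤ 2 * S / (k1 * k1) := by rw [le_div_iff₀ (by positivity)]; linarith
  refine (Finset.sum_le_sum t).trans ?_
  rw [← Finset.mul_sum, Finset.sum_add_distrib, Finset.sum_add_distrib, ← Finset.mul_sum,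
    ← Finset.mul_sum, ← Finset.sum_mul]
  calc _ ≤ c * (C / k1 * S + C / k1 * S + Ks * (2 * S / (k1 * k1))) := by gcongr
    _ = _ := by ring

/-- Theorem (finite α-th moment): for a symmetric integrable kernel that is non-increasing on ℕ,
has finite α-th moment (α ∈ (1,2]) and satisfies `k(j) ≤ C k(j+1)`, there is `d > 0` with
`Ψ_{2,Υ}(u)(x) ≥ (1/d)|Lu(x)|^γ`, `γ = α/(α−1)`, for all bounded `u` and all `x`. -/
theorem moment_CD (k : ℤ → ℝ) (hk : IsKernel k) (α γ : ℝ)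
    (hα1 : 1 < α) (hα2 : α ≤ 2) (hγ : γ = α / (α - 1))
    (hmom : Summable fun n : ℕ => k (n : ℤ) * (n : ℝ) ^ α)
    (hmono : ∀ n : ℕ, 1 ≤ n → k ((n : ℤ) + 1) ≤ k (n : ℤ))
    (C : ℝ) (hC : 1 ≤ C) (hgrow : ∀ n : ℕ, 1 ≤ n → k (n : ℤ) ≤ C * k ((n : ℤ) + 1)) :
    ∃ d : ℝ, 0 < d ∧ ∀ u : ℤ → ℝ, BddFun u → ∀ x : ℤ,
      (1 / d) * |Lop k u x| ^ γ ≤ Psi2 k u x := by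
  have hα0 : 0 < α - 1 := by linarith
  have hγ2 : 2 ≤ γ := by rw [hγ, le_div_iff₀ hα0]; linarith
  have hγ0 : 0 < γ := by linarith
  obtain ⟨hnn, hk0, hsymm, hsum, hnt⟩ := hk
  let κ : ℕ → ℝ := fun n => k (n:ℤ)
  have hκ : ∀ n, 0 ≤ κ n := fun n => hnn _
  have hanti : ∀ i n, 1 ≤ i → i ≤ n → κ n ≤ κ i := by
    intro i n hi hin
    induction n, hin using Nat.le_induction with
    | base => exact le_rfl
    | succ n hn ih =>
      refine le_trans ?_ ih
      have := hmono n (by omega)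
      simpa [κ] using this
  have hk1 : 0 < k 1 := by
    obtain ⟨j, hj⟩ := hnt
    have hj0 : j ≠ 0 := fun h => hj (h ▸ hk0)
    have h1 := hanti 1 j.natAbs le_rfl (by omega)
    have h2 : κ j.natAbs = k j := by
      simp only [κ]
      rcases Int.natAbs_eq j with h | h
      · rw [← h]
      · conv_rhs => rw [h, hsymm]
    rw [h2] at h1
    have h3 : k j ≤ k 1 := by simpa [κ] using h1
    exact lt_of_lt_of_le (lt_of_le_of_ne (hnn j) (Ne.symm hj)) h3
  have hκs : Summable κ := hsum.comp_injective Nat.cast_injective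
  set Ks := ∑' n, κ n with hKs
  have hKs0 : 0 ≤ Ks := tsum_nonneg hκ
  set M := ∑' n : ℕ, k (n : ℤ) * (n : ℝ) ^ α with hM
  have hM0 : 0 ≤ M := tsum_nonneg fun n => mul_nonneg (hnn _) (by positivity)
  obtain ⟨K, hK, hKt⟩ := pow_exp γ hγ2
  set c := 128 * K * 4 ^ γ with hc
  have hc0 : 0 < c := by positivity
  set c1 := c * (2 * C / k 1 + 2 * Ks / (k 1 * k 1)) with hc1
  have hc10 : 0 ≤ c1 := by positivity
  set c2 := (2 * M)^(γ-1) * (2 * c1) with hc2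
  have hc20 : 0 ≤ c2 := by positivity
  set c3 := Ks^γ * (64 * K * (2 / (k 1 * k 1))) with hc3
  have hc30 : 0 ≤ c3 := by positivity
  set c4 := c2 + c3 + 1 with hc4
  have hc40 : 0 < c4 := by positivity
  refine ⟨3^γ * c4 * 2, by positivity, fun u hu x => ?_⟩
  obtain ⟨B, hB⟩ := hu
  let f : ℤ → ℝ := fun j => u (x + j) - u x
  have hf0 : f 0 = 0 := by simp [f]
  have hfB : ∀ j, |f j| ≤ 2 * B := fun j => by
    have h1 := abs_le.1 (hB (x+j)); have h2 := abs_le.1 (hB x)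
    rw [abs_le]; constructor <;> simp only [f] <;> linarith
  have hT := TT_summable k f hnn hsum _ hfB
  set S := ∑' p, TT k f p with hS
  have hS0 : 0 ≤ S := tsum_nonneg (TT_nonneg k f hnn)
  have hPsi : Psi2 k u x = 1 / 2 * S := by
    unfold Psi2
    congr 1
    refine tsum_congr fun p => ?_
    simp only [TT, f]
    rw [← add_assoc]
    congr 2
    ring
  have hLs : Summable fun j => k j * f j := by
    refine Summable.of_norm_bounded (hsum.mul_right (2 * B)) fun j => ?_
    rw [Real.norm_eq_abs, abs_mul, abs_of_nonneg (hnn j)]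
    exact mul_le_mul_of_nonneg_left (hfB j) (hnn j)
  have hLH : HasSum (fun n : ℕ => κ n * (f n + f (-n))) (Lop k u x) := by
    have h := hLs.hasSum.nat_add_neg
    have e : (∑' j, k j * f j) + k 0 * f 0 = Lop k u x := by
      rw [hf0, mul_zero, add_zero]; rfl
    rw [e] at h
    refine h.congr_fun ?_
    intro n
    rw [hsymm]; simp only [κ]; ring
  set a := f 1 with ha
  set b := f (-1) with hb
  let w : ℕ → ℝ := fun n => f (n+1) - f n - a
  let y : ℕ → ℝ := fun n => f (-n) - f (-n-1) - a
  have hvp : ∀ n : ℕ, 1 ≤ n → f n = n * a + ∑ i ∈ Finset.Ico 1 n, w i := by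
    intro n hn
    induction n, hn using Nat.le_induction with
    | base => simp [ha]
    | succ n hn ih =>
      rw [Finset.sum_Ico_succ_top hn]
      simp only [w] at ih ⊢
      push_cast
      linarith
  have hvn : ∀ n : ℕ, 1 ≤ n → f (-n) = - n * a + (a + b) - ∑ i ∈ Finset.Ico 1 n, y i := by
    intro n hn
    induction n, hn using Nat.le_induction with
    | base => simp [hb]
    | succ n hn ih =>
      rw [Finset.sum_Ico_succ_top hn]
      simp only [y] at ih ⊢
      have : (-((n+1:ℕ):ℤ)) = -(n:ℤ)-1 := by push_cast; ring
      rw [this]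
      push_cast
      linarith
  have hG : k 1 * k 1 * ((Real.exp a + Real.exp b) * Ups (-(a+b))) ≤ 2 * S := by
    have h1 := hT.le_tsum ((-1:ℤ), (1:ℤ)) (fun j _ => TT_nonneg k f hnn j)
    have h2 := hT.le_tsum ((1:ℤ), (-1:ℤ)) (fun j _ => TT_nonneg k f hnn j)
    have e1 : TT k f (-1, 1) = k 1 * k 1 * (Real.exp a * Ups (-(a+b))) := by
      simp only [TT, hsymm 1, neg_add_cancel, hf0, ← ha, ← hb]
      rw [show 0 - b - a = -(a+b) by ring]; ring
    have e2 : TT k f (1, -1) = k 1 * k 1 * (Real.exp b * Ups (-(a+b))) := by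
      simp only [TT, hsymm 1, add_neg_cancel, hf0, ← ha, ← hb]
      rw [show 0 - a - b = -(a+b) by ring]; ring
    rw [e1] at h1
    rw [e2] at h2
    linarith
  have hsS : |a+b|^γ ≤ 64 * K * (2 / (k 1 * k 1)) * S := by
    refine (scalar_s γ K hK hKt a b).trans ?_
    have : (Real.exp a + Real.exp b) * Ups (-(a+b)) ≤ 2 / (k 1 * k 1) * S := by
      rw [div_mul_eq_mul_div, le_div_iff₀ (by positivity)]; linarith
    calc _ ≤ 64 * K * (2 / (k 1 * k 1) * S) := by gcongr
      _ = _ := by ring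
  have hgrow' : ∀ n : ℕ, 1 ≤ n → κ n ≤ C * κ (n+1) := by
    intro n hn
    have := hgrow n hn
    simpa [κ] using this
  have hself : ∀ n : ℕ, κ n ≤ C * κ n := fun n => le_mul_of_one_le_left (hκ n) hC
  have hKsN : ∀ N, ∑ n ∈ Finset.Ico 1 N, κ n ≤ Ks := fun N =>
    hκs.sum_le_tsum _ fun n _ => hκ n
  have aux : ∀ p q t v : ℝ, p ≤ C * q → 0 ≤ v → t = q * v → p * v ≤ C * t := by
    intro p q t v h hv ht
    rw [ht, ← mul_assoc]; gcongr
  have hw1 : ∀ N, ∑ n ∈ Finset.Ico 1 N, κ n * |w n|^γ ≤ c1 * S := by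
    intro N
    refine side κ w (fun n => TT k f ((n:ℤ), 1)) (fun n => TT k f ((n:ℤ)+1, -1)) γ c a b (k 1) C S Ks N
      hκ hc0 hk1 hC (scalar_w γ K hγ2 hK hKt a b) ?_ ?_ ?_ ?_ hS0 hG (hKsN N)
    · intro n hn
      refine aux _ (κ n) _ _ (hself n) (mul_nonneg hk1.le (mul_nonneg (Real.exp_pos _).le (Ups_nonneg _))) ?_
      simp only [TT, κ, w, ← ha]; ring
    · intro n hn
      refine aux _ (κ (n+1)) _ _ (hgrow' n hn) (mul_nonneg hk1.le (mul_nonneg (Real.exp_pos _).le (Ups_nonneg _))) ?_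
      simp only [TT, κ, w, ← hb, hsymm 1]
      rw [show (n:ℤ) + 1 + -1 = n by ring]
      push_cast
      rw [show f n - f (n+1) - b = -(f (n+1) - f n - a) - (a+b) by ring]; ring
    · exact TT_sum_le k f hnn hT (fun n => ((n:ℤ), 1)) (fun m n h => by simpa using h) _
    · exact TT_sum_le k f hnn hT (fun n => ((n:ℤ)+1, -1)) (fun m n h => by simpa using h) _
  have hy1 : ∀ N, ∑ n ∈ Finset.Ico 1 N, κ n * |y n|^γ ≤ c1 * S := by
    intro N
    refine side κ y (fun n => TT k f (-(n:ℤ)-1, 1)) (fun n => TT k f (-(n:ℤ), -1)) γ c a b (k 1) C S Ks N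
      hκ hc0 hk1 hC (scalar_w γ K hγ2 hK hKt a b) ?_ ?_ ?_ ?_ hS0 hG (hKsN N)
    · intro n hn
      refine aux _ (κ (n+1)) _ _ (hgrow' n hn) (mul_nonneg hk1.le (mul_nonneg (Real.exp_pos _).le (Ups_nonneg _))) ?_
      have e : k (-(n:ℤ)-1) = κ (n+1) := by
        rw [← hsymm]; simp only [κ]; congr 1; push_cast; ring
      simp only [TT, y, ← ha, e]
      rw [show -(n:ℤ) - 1 + 1 = -n by ring]
      ring
    · intro n hn
      refine aux _ (κ n) _ _ (hself n) (mul_nonneg hk1.le (mul_nonneg (Real.exp_pos _).le (Ups_nonneg _))) ?_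
      simp only [TT, κ, y, ← hb, hsymm]
      rw [show -(n:ℤ) + -1 = -n - 1 by ring]
      rw [show f (-n-1) - f (-n) - b = -(f (-n) - f (-n-1) - a) - (a+b) by ring]; ring
    · exact TT_sum_le k f hnn hT (fun n => (-(n:ℤ)-1, 1)) (fun m n h => by simpa using h) _
    · exact TT_sum_le k f hnn hT (fun n => (-(n:ℤ), -1)) (fun m n h => by simpa using h) _
  have hMN : ∀ N, ∑ n ∈ Finset.range N, κ n * (n:ℝ)^α ≤ M := fun N =>
    hmom.sum_le_tsum _ fun n _ => mul_nonneg (hκ n) (by positivity)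
  set R := (c4 * S)^(γ⁻¹) with hR
  have toR : ∀ t : ℝ, 0 ≤ t → t^γ ≤ c4 * S → t ≤ R := by
    intro t ht h
    rw [hR, Real.le_rpow_inv_iff_of_pos ht (by positivity) hγ0]; exact h
  have hard : ∀ z : ℕ → ℝ, (∀ N, ∑ n ∈ Finset.Ico 1 N, κ n * |z n|^γ ≤ c1 * S) → ∀ N,
      ∑ n ∈ Finset.range N, κ n * ∑ i ∈ Finset.Ico 1 n, |z i| ≤ R := by
    intro z hz N
    refine toR _ (Finset.sum_nonneg fun n _ => mul_nonneg (hκ n) (Finset.sum_nonneg fun i _ => abs_nonneg _)) ?_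
    refine (hardy κ (fun i => |z i|) α γ hα1 hα2 hγ hκ (fun i => abs_nonneg _) hanti N M (hMN N)).trans ?_
    calc _ ≤ (2 * M)^(γ-1) * (2 * (c1 * S)) := by gcongr; exact hz N
      _ = c2 * S := by rw [hc2]; ring
      _ ≤ c4 * S := by gcongr; rw [hc4]; linarith
  have hsR : Ks * |a+b| ≤ R := by
    refine toR _ (by positivity) ?_
    rw [Real.mul_rpow hKs0 (abs_nonneg _)]
    calc _ ≤ Ks^γ * (64 * K * (2 / (k 1 * k 1)) * S) := by gcongr
      _ = c3 * S := by rw [hc3]; ring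
      _ ≤ c4 * S := by gcongr; rw [hc4]; linarith
  have hfin : ∀ N, |∑ n ∈ Finset.range N, κ n * (f n + f (-n))| ≤ 3 * R := by
    intro N
    have t : ∀ n ∈ Finset.range N, |κ n * (f n + f (-n))| ≤
        κ n * (∑ i ∈ Finset.Ico 1 n, |w i|) + κ n * (∑ i ∈ Finset.Ico 1 n, |y i|) + κ n * |a+b| := by
      intro n _
      rw [abs_mul, abs_of_nonneg (hκ n), ← mul_add, ← mul_add]
      refine mul_le_mul_of_nonneg_left ?_ (hκ n)
      rcases Nat.eq_zero_or_pos n with h0 | h0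
      · subst h0; simp [hf0]
      rw [hvp n h0, hvn n h0]
      have e : (n:ℝ) * a + ∑ i ∈ Finset.Ico 1 n, w i + (-n * a + (a+b) - ∑ i ∈ Finset.Ico 1 n, y i)
        = ∑ i ∈ Finset.Ico 1 n, w i - ∑ i ∈ Finset.Ico 1 n, y i + (a+b) := by ring
      rw [e]
      have h1 := Finset.abs_sum_le_sum_abs w (Finset.Ico 1 n)
      have h2 := Finset.abs_sum_le_sum_abs y (Finset.Ico 1 n)
      have h3 := abs_add_le (∑ i ∈ Finset.Ico 1 n, w i - ∑ i ∈ Finset.Ico 1 n, y i) (a+b)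
      have h4 := abs_sub (∑ i ∈ Finset.Ico 1 n, w i) (∑ i ∈ Finset.Ico 1 n, y i)
      linarith
    refine (Finset.abs_sum_le_sum_abs _ _).trans ((Finset.sum_le_sum t).trans ?_)
    rw [Finset.sum_add_distrib, Finset.sum_add_distrib, ← Finset.sum_mul]
    have h1 := hard w hw1 N
    have h2 := hard y hy1 N
    have h3 : (∑ n ∈ Finset.range N, κ n) * |a+b| ≤ Ks * |a+b| := by
      gcongr; exact hκs.sum_le_tsum _ fun n _ => hκ n
    linarith
  have hL : |Lop k u x| ≤ 3 * R :=
    le_of_tendsto hLH.tendsto_sum_nat.abs (Eventually.of_forall hfin)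
  have hLγ : |Lop k u x|^γ ≤ 3^γ * (c4 * S) := by
    calc _ ≤ (3 * R)^γ := by gcongr
      _ = _ := by
        rw [Real.mul_rpow (by norm_num) (by positivity), hR, Real.rpow_inv_rpow (by positivity) hγ0.ne']
  rw [hPsi, one_div_mul_eq_div, div_le_iff₀ (by positivity)]
  calc _ ≤ _ := hLγ
    _ = _ := by ring
end
end

section
/- Let k: ℤ → [0,∞) be a nontrivial kernel with k(0)=0, k(−j)=k(j) for all j ∈ ℤ, and |k|₁ := ∑_{j∈ℤ} k(j) < ∞, with support S = {j : k(j) > 0}. Suppose ∑_{j∈S} k(j) log(2 + 1/k(j)) < ∞, and let G(a) = ∫₀^a ρ^{−1}(s) ds where ρ(λ) = ∑_{j∈S} k(j)(H')^{−1}(λ/k(j)) for λ > 0 and ρ(0)=0. Then: (1) the operator L generated by k satisfies CD_Υ(0,G); (2) G is strictly convex on [0,∞); (3) G(a) / ( (|k|₁/2) · e^{(a − M(k))/|k|₁} ) → 1 as a → ∞, where M(k) = ∑_{j∈S} k(j) log(1/k(j)). -/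
open scoped BigOperators
open Filter Set

noncomputable section

/-- The derivative `H'(x) = (1/2)(e^x − e^{−x} + 2x e^{−x})` of `H`. -/
def HD (x : ℝ) : ℝ := (1 / 2) * (Real.exp x - Real.exp (-x) + 2 * x * Real.exp (-x))

/-- The inverse function `(H')^{−1}` (well defined since `H'` is a strictly increasing
bijection of `ℝ`). -/
def HDinv : ℝ → ℝ := Function.invFun HD

/-- `ρ(λ) = ∑_{j∈S} k(j) (H')^{−1}(λ/k(j))` for `λ > 0`, `ρ(λ)=0` for `λ ≤ 0`
(note that the summands with `k(j) = 0` vanish). -/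
def rho (k : ℤ → ℝ) (lam : ℝ) : ℝ :=
  if lam ≤ 0 then 0 else ∑' j : ℤ, k j * HDinv (lam / k j)

/-- The inverse function `ρ^{−1}` of `ρ`. -/
def rhoInv (k : ℤ → ℝ) : ℝ → ℝ := Function.invFun (rho k)

/-- `G(a) = ∫_0^a ρ^{−1}(s) ds`. -/
def Gfun (k : ℤ → ℝ) (a : ℝ) : ℝ := ∫ s in (0:ℝ)..a, rhoInv k s

lemma aux_HD_hasDeriv (x : ℝ) :
    HasDerivAt HD ((1 / 2) * (Real.exp x + (3 - 2 * x) * Real.exp (-x))) x := by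
  have h1 := Real.hasDerivAt_exp x
  have h2 : HasDerivAt (fun x : ℝ => Real.exp (-x)) (Real.exp (-x) * (-1)) x :=
    (hasDerivAt_neg x).exp
  have h3 : HasDerivAt (fun x : ℝ => 2 * x) (2 * 1) x := (hasDerivAt_id x).const_mul 2
  have := ((h1.sub h2).add (h3.mul h2)).const_mul (1 / 2 : ℝ)
  refine this.congr_deriv ?_
  ring

lemma aux_H_hasDeriv (x : ℝ) : HasDerivAt Hfun (HD x) x := by
  have h2 : HasDerivAt (fun x : ℝ => Real.exp (-x)) (Real.exp (-x) * (-1)) x :=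
    (hasDerivAt_neg x).exp
  have h3 : HasDerivAt (fun x : ℝ => 2 * x) (2 * 1) x := (hasDerivAt_id x).const_mul 2
  have h4 : HasDerivAt (fun x : ℝ => Ups (2 * x)) (Real.exp (2 * x) * (2 * 1) - 2 * 1) x :=
    (h3.exp.sub_const 1).sub h3
  have := (h2.const_mul (1 / 2 : ℝ)).mul h4
  refine this.congr_deriv ?_
  have e : Real.exp (2 * x) = Real.exp x * Real.exp x := by rw [← Real.exp_add]; ring_nf
  have e2 : Real.exp (-x) * Real.exp x = 1 := by rw [← Real.exp_add]; simp
  unfold HD Ups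
  rw [e]
  linear_combination (1 / 2) * Real.exp x * e2

lemma aux_HD_strictMono : StrictMono HD := by
  apply strictMono_of_deriv_pos
  intro x
  rw [(aux_HD_hasDeriv x).deriv]
  have e : Real.exp (2 * x) = Real.exp x * Real.exp x := by rw [← Real.exp_add]; ring_nf
  have e2 : Real.exp (-x) * Real.exp x = 1 := by rw [← Real.exp_add]; simp
  have h1 := Real.add_one_le_exp (2 * x)
  have h : Real.exp x + (3 - 2 * x) * Real.exp (-x)
      = Real.exp (-x) * (Real.exp (2 * x) + 3 - 2 * x) := by
    rw [e]; linear_combination (-Real.exp x) * e2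
  rw [h]
  have := Real.exp_pos (-x)
  have : 0 < Real.exp (2 * x) + 3 - 2 * x := by linarith
  positivity

lemma aux_HD_zero : HD 0 = 0 := by simp [HD]

lemma aux_HD_lower {x : ℝ} (hx : 0 ≤ x) : (Real.exp x - 1) / 2 ≤ HD x := by
  unfold HD
  have h1 : Real.exp (-x) ≤ 1 := by simpa using hx
  have h2 : 0 ≤ 2 * x * Real.exp (-x) := by positivity
  linarith

lemma aux_HD_cont : Continuous HD :=
  continuous_iff_continuousAt.2 fun x => (aux_HD_hasDeriv x).continuousAt

lemma aux_HD_surj : Function.Surjective HD := by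
  apply aux_HD_cont.surjective
  · refine tendsto_atTop_mono' atTop (f₁ := fun x : ℝ => x / 2) ?_
      (tendsto_id.atTop_div_const (by norm_num))
    filter_upwards [eventually_ge_atTop 0] with x hx
    have := aux_HD_lower hx
    have := Real.add_one_le_exp x
    linarith
  · refine tendsto_atBot_mono' atBot (f₁ := fun x : ℝ => x) ?_ tendsto_id
    filter_upwards [eventually_le_atBot 0] with x hx
    unfold HD
    have h1 : Real.exp x ≤ Real.exp (-x) := Real.exp_le_exp.2 (by linarith)
    have h2 : 1 ≤ Real.exp (-x) := Real.one_le_exp (by linarith)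
    nlinarith

def auxHDiso : ℝ ≃o ℝ := aux_HD_strictMono.orderIsoOfSurjective HD aux_HD_surj

lemma aux_HD_inv (y : ℝ) : HD (HDinv y) = y := Function.rightInverse_invFun aux_HD_surj y

lemma aux_HDinv_eq : HDinv = auxHDiso.symm := by
  funext y
  apply aux_HD_strictMono.injective
  rw [aux_HD_inv]
  exact (auxHDiso.apply_symm_apply y).symm

lemma aux_HDinv_strictMono : StrictMono HDinv := by
  rw [aux_HDinv_eq]; exact auxHDiso.symm.strictMono

lemma aux_HDinv_cont : Continuous HDinv := by
  rw [aux_HDinv_eq]; exact auxHDiso.symm.continuous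

lemma aux_HDinv_tendsto : Tendsto HDinv atTop atTop := by
  rw [aux_HDinv_eq]; exact auxHDiso.symm.tendsto_atTop

lemma aux_HDinv_zero : HDinv 0 = 0 := by
  apply aux_HD_strictMono.injective; rw [aux_HD_inv, aux_HD_zero]

lemma aux_HDinv_nonneg {y : ℝ} (hy : 0 ≤ y) : 0 ≤ HDinv y := by
  rw [← aux_HDinv_zero]; exact aux_HDinv_strictMono.monotone hy

lemma aux_HDinv_le {y : ℝ} (hy : 0 ≤ y) : HDinv y ≤ Real.log (1 + 2 * y) := by
  have h := aux_HD_lower (aux_HDinv_nonneg hy)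
  rw [aux_HD_inv] at h
  rw [Real.le_log_iff_exp_le (by linarith)]
  linarith

lemma aux_H_zero : Hfun 0 = 0 := by simp [Hfun, Ups]

lemma aux_H_tangent (s t : ℝ) : Hfun t + HD t * (s - t) ≤ Hfun s := by
  have hc : ConvexOn ℝ univ Hfun := by
    apply Monotone.convexOn_univ_of_deriv
    · exact fun x => (aux_H_hasDeriv x).differentiableAt
    · have : deriv Hfun = HD := funext fun x => (aux_H_hasDeriv x).deriv
      rw [this]; exact aux_HD_strictMono.monotone
  rcases lt_trichotomy s t with h | h | h
  · have := hc.slope_le_of_hasDerivAt (mem_univ _) (mem_univ _) h (aux_H_hasDeriv t)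
    rw [slope_def_field, div_le_iff₀ (by linarith)] at this
    linarith
  · subst h; simp
  · have := hc.le_slope_of_hasDerivAt (mem_univ _) (mem_univ _) h (aux_H_hasDeriv t)
    rw [slope_def_field, le_div_iff₀ (by linarith)] at this
    linarith

lemma aux_H_nonneg (s : ℝ) : 0 ≤ Hfun s := by
  have := aux_H_tangent s 0
  rw [aux_H_zero, aux_HD_zero] at this; linarith

lemma aux_H_eq (t : ℝ) : Hfun t = HD t - 2 * (t * Real.exp (-t)) := by
  have e : Real.exp (2 * t) = Real.exp t * Real.exp t := by rw [← Real.exp_add]; ring_nf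
  have e2 : Real.exp (-t) * Real.exp t = 1 := by rw [← Real.exp_add]; simp
  unfold Hfun HD Ups
  rw [e]
  linear_combination (1 / 2) * Real.exp t * e2

lemma aux_log_tendsto : Tendsto (fun y => Real.log (2 * y) - HDinv y) atTop (nhds 0) := by
  have key : Tendsto (fun x => Real.log (2 * HD x) - x) atTop (nhds 0) := by
    have h1 : Tendsto (fun x : ℝ => 1 + (2 * x * Real.exp (-(2 * x)) - Real.exp (-(2 * x))))
        atTop (nhds (1 + (0 - 0))) := by
      have h2 : Tendsto (fun x : ℝ => 2 * x) atTop atTop :=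
        tendsto_id.const_mul_atTop (by norm_num)
      have h3 := (Real.tendsto_pow_mul_exp_neg_atTop_nhds_zero 1).comp h2
      have h4 := (Real.tendsto_exp_neg_atTop_nhds_zero).comp h2
      refine tendsto_const_nhds.add ((h3.congr ?_).sub (h4.congr ?_))
      · intro x; simp
      · intro x; simp
    rw [sub_zero, add_zero] at h1
    have h5 := (Real.continuousAt_log one_ne_zero).tendsto.comp h1
    rw [Real.log_one] at h5
    refine h5.congr' ?_
    filter_upwards [eventually_gt_atTop 0] with x hx
    have hp : 0 < HD x := by rw [← aux_HD_zero]; exact aux_HD_strictMono hx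
    have e : Real.exp (-(2 * x)) = Real.exp (-x) * Real.exp (-x) := by
      rw [← Real.exp_add]; ring_nf
    have e2 : Real.exp (-x) * Real.exp x = 1 := by rw [← Real.exp_add]; simp
    have : 1 + (2 * x * Real.exp (-(2 * x)) - Real.exp (-(2 * x)))
        = 2 * HD x * Real.exp (-x) := by
      unfold HD; rw [e]; linear_combination -e2
    simp only [Function.comp]
    rw [this, Real.log_mul (by positivity) (by positivity), Real.log_exp]
    ring
  refine (key.comp aux_HDinv_tendsto).congr ?_
  intro y
  simp [aux_HD_inv]

lemma aux_deriv_of_subgrad {f g : ℝ → ℝ} (hg : Continuous g)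
    (h : ∀ a b, f a + g a * (b - a) ≤ f b) (a : ℝ) : HasDerivAt f (g a) a := by
  rw [hasDerivAt_iff_isLittleO, Asymptotics.isLittleO_iff]
  intro c hc
  have := Metric.continuous_iff.1 hg a c hc
  obtain ⟨δ, hδ, hd⟩ := this
  filter_upwards [Metric.ball_mem_nhds a hδ] with b hb
  have h1 := h a b
  have h2 := h b a
  have h3 := (hd b hb).le
  rw [Real.dist_eq] at h3
  rw [smul_eq_mul, Real.norm_eq_abs, Real.norm_eq_abs, abs_of_nonneg (by linarith)]
  calc f b - f a - (b - a) * g a ≤ (g b - g a) * (b - a) := by linarith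
    _ ≤ |(g b - g a) * (b - a)| := le_abs_self _
    _ = |g b - g a| * |b - a| := abs_mul _ _
    _ ≤ c * |b - a| := by gcongr

def auxR (k : ℤ → ℝ) (l : ℝ) : ℝ := ∑' j : ℤ, k j * HDinv (l / k j)
def auxW (k : ℤ → ℝ) (l : ℝ) : ℝ := ∑' j : ℤ, k j ^ 2 * Hfun (HDinv (l / k j))

section
variable {k : ℤ → ℝ} (hk : IsKernel k) (hlog : Summable fun j : ℤ => k j * Real.log (2 + 1 / k j))

lemma aux_term_nonneg (hk : IsKernel k) {l : ℝ} (hl : 0 ≤ l) (j : ℤ) :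
    0 ≤ k j * HDinv (l / k j) :=
  mul_nonneg (hk.nonneg j) (aux_HDinv_nonneg (div_nonneg hl (hk.nonneg j)))

lemma aux_term_le (hk : IsKernel k) {l L : ℝ} (hl : 0 ≤ l) (hL : l ≤ L) (j : ℤ) :
    k j * HDinv (l / k j) ≤ k j * Real.log (2 + 1 / k j) + k j * Real.log (1 + 2 * L) := by
  rcases (hk.nonneg j).eq_or_lt with h | h
  · simp [← h]
  · rw [← mul_add]
    refine mul_le_mul_of_nonneg_left ?_ h.le
    refine (aux_HDinv_le (div_nonneg hl h.le)).trans ?_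
    have hL0 : 0 ≤ L := hl.trans hL
    rw [← Real.log_mul (by positivity) (by positivity)]
    apply Real.log_le_log (by positivity)
    have : l / k j ≤ L / k j := by gcongr
    have e : (2 + 1 / k j) * (1 + 2 * L) = 2 + 4 * L + 1 / k j + 2 * (L / k j) := by ring
    rw [e]
    have : 0 < 1 / k j := by positivity
    linarith

lemma aux_bound_summable (hk : IsKernel k)
    (hlog : Summable fun j : ℤ => k j * Real.log (2 + 1 / k j)) (L : ℝ) :
    Summable fun j : ℤ => k j * Real.log (2 + 1 / k j) + k j * Real.log (1 + 2 * L) :=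
  hlog.add (hk.summable.mul_right _)

lemma aux_R_summable (hk : IsKernel k)
    (hlog : Summable fun j : ℤ => k j * Real.log (2 + 1 / k j)) {l : ℝ} (hl : 0 ≤ l) :
    Summable fun j : ℤ => k j * HDinv (l / k j) :=
  (aux_bound_summable hk hlog l).of_nonneg_of_le (aux_term_nonneg hk hl)
    (aux_term_le hk hl le_rfl)

lemma aux_R_zero : auxR k 0 = 0 := by simp [auxR, aux_HDinv_zero]

lemma aux_R_strict (hk : IsKernel k)
    (hlog : Summable fun j : ℤ => k j * Real.log (2 + 1 / k j)) {a b : ℝ}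
    (ha : 0 ≤ a) (hab : a < b) : auxR k a < auxR k b := by
  obtain ⟨i, hi⟩ := hk.nontrivial
  have hi : 0 < k i := lt_of_le_of_ne (hk.nonneg i) hi.symm
  refine Summable.tsum_lt_tsum (i := i) ?_ ?_ (aux_R_summable hk hlog ha)
    (aux_R_summable hk hlog (ha.trans hab.le))
  · intro j
    refine mul_le_mul_of_nonneg_left (aux_HDinv_strictMono.monotone ?_) (hk.nonneg j)
    exact div_le_div_of_nonneg_right hab.le (hk.nonneg j)
  · refine mul_lt_mul_of_pos_left (aux_HDinv_strictMono ?_) hi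
    exact div_lt_div_of_pos_right hab hi

lemma aux_R_cont (hk : IsKernel k)
    (hlog : Summable fun j : ℤ => k j * Real.log (2 + 1 / k j)) :
    Continuous (fun l => auxR k (max l 0)) := by
  rw [continuous_iff_continuousAt]
  intro x
  have : ContinuousOn (fun l => auxR k (max l 0)) (Iio (x + 1)) := by
    refine continuousOn_tsum (u := fun j => k j * Real.log (2 + 1 / k j) +
      k j * Real.log (1 + 2 * (max (x + 1) 0))) ?_ (aux_bound_summable hk hlog _) ?_
    · intro j
      apply Continuous.continuousOn
      exact continuous_const.mul (aux_HDinv_cont.comp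
        ((continuous_id.max continuous_const).div_const _))
    · intro j l hl
      rw [Real.norm_eq_abs, abs_of_nonneg (aux_term_nonneg hk (le_max_right _ _) j)]
      exact aux_term_le hk (le_max_right _ _) (max_le_max_right 0 (le_of_lt hl)) j
  exact this.continuousAt (Iio_mem_nhds (by linarith))

/-- extension of R to the whole line -/
def auxE (k : ℤ → ℝ) (l : ℝ) : ℝ := auxR k (max l 0) + min l 0

lemma aux_E_strictMono (hk : IsKernel k)
    (hlog : Summable fun j : ℤ => k j * Real.log (2 + 1 / k j)) : StrictMono (auxE k) := by
  have hm : ∀ {a b : ℝ}, 0 ≤ a → a ≤ b → auxR k a ≤ auxR k b := by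
    intro a b ha hab
    rcases hab.eq_or_lt with h | h
    · rw [h]
    · exact (aux_R_strict hk hlog ha h).le
  intro a b hab
  unfold auxE
  rcases lt_or_ge a 0 with h | h
  · have : auxR k (max a 0) ≤ auxR k (max b 0) := hm (le_max_right _ _) (max_le_max_right 0 hab.le)
    have h2 : min a 0 < min b 0 := by
      rw [min_eq_left h.le]; exact lt_min hab h
    linarith
  · rw [max_eq_left h, min_eq_right h, max_eq_left (h.trans hab.le), min_eq_right (h.trans hab.le)]
    have := aux_R_strict hk hlog h hab
    linarith

lemma aux_E_surj (hk : IsKernel k)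
    (hlog : Summable fun j : ℤ => k j * Real.log (2 + 1 / k j)) :
    Function.Surjective (auxE k) := by
  have hc : Continuous (auxE k) :=
    (aux_R_cont hk hlog).add (continuous_id.min continuous_const)
  apply hc.surjective
  · obtain ⟨i, hi⟩ := hk.nontrivial
    have hi : 0 < k i := lt_of_le_of_ne (hk.nonneg i) hi.symm
    refine tendsto_atTop_mono' atTop (f₁ := fun l => k i * HDinv (l / k i)) ?_ ?_
    · filter_upwards [eventually_ge_atTop 0] with l hl
      unfold auxE
      rw [max_eq_left hl, min_eq_right hl, add_zero]
      exact (aux_R_summable hk hlog hl).le_tsum i (fun j _ => aux_term_nonneg hk hl j)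
    · exact (aux_HDinv_tendsto.comp (tendsto_id.atTop_div_const hi)).const_mul_atTop hi
  · refine tendsto_atBot_mono' atBot (f₁ := fun x : ℝ => x) ?_ tendsto_id
    filter_upwards [eventually_le_atBot 0] with l hl
    simp [auxE, max_eq_right hl, min_eq_left hl, aux_R_zero]

lemma aux_lam_exists (hk : IsKernel k)
    (hlog : Summable fun j : ℤ => k j * Real.log (2 + 1 / k j)) :
    ∃ lp : ℝ → ℝ, Continuous lp ∧ (∀ a, 0 ≤ lp a) ∧ (∀ a, auxR k (lp a) = max a 0) ∧
      (∀ a ≤ 0, lp a = 0) ∧ StrictMonoOn lp (Ici 0) ∧ Tendsto lp atTop atTop ∧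
      ∀ a, 0 < a → rhoInv k a = lp a := by
  let e : ℝ ≃o ℝ := (aux_E_strictMono hk hlog).orderIsoOfSurjective _ (aux_E_surj hk hlog)
  have he : ∀ x, e x = auxE k x := fun x => rfl
  have he0 : e 0 = 0 := by rw [he]; simp [auxE, aux_R_zero]
  have hs0 : e.symm 0 = 0 := by rw [← he0, e.symm_apply_apply, he0]
  have hpos : ∀ x, 0 ≤ x → 0 ≤ e.symm x := fun x hx => by
    rw [← hs0]; exact e.symm.monotone hx
  have hneg : ∀ x, x ≤ 0 → e.symm x ≤ 0 := fun x hx => by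
    rw [← hs0]; exact e.symm.monotone hx
  have hR : ∀ a, 0 ≤ a → auxR k (e.symm a) = a := by
    intro a h
    have := e.apply_symm_apply a
    rw [he, auxE, max_eq_left (hpos a h), min_eq_right (hpos a h), add_zero] at this
    exact this
  refine ⟨fun a => max (e.symm a) 0, e.symm.continuous.max continuous_const,
    fun a => le_max_right _ _, ?_, ?_, ?_, ?_, ?_⟩
  · intro a
    rcases le_total 0 a with h | h
    · simp only [max_eq_left (hpos a h), max_eq_left h]
      exact hR a h
    · simp only [max_eq_right (hneg a h), max_eq_right h, aux_R_zero]
  · intro a h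
    exact max_eq_right (hneg a h)
  · intro a ha b hb hab
    simp only [max_eq_left (hpos a ha), max_eq_left (hpos b hb)]
    exact e.symm.strictMono hab
  · exact tendsto_atTop_mono (fun a => le_max_left _ _) e.symm.tendsto_atTop
  · intro a ha
    have hr : rho k (e.symm a) = a := by
      have h0 : 0 < e.symm a := by rw [← hs0]; exact e.symm.strictMono ha
      unfold rho
      rw [if_neg (not_le.2 h0)]
      exact hR a ha.le
    have h1 : rho k (rhoInv k a) = a := Function.invFun_eq (f := rho k) ⟨_, hr⟩
    have h2 : 0 < rhoInv k a := by
      by_contra h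
      unfold rho at h1
      rw [if_pos (not_lt.1 h)] at h1
      exact ha.ne h1
    unfold rho at h1
    rw [if_neg (not_le.2 h2)] at h1
    simp only [max_eq_left (hpos a ha.le)]
    rw [eq_comm, e.symm_apply_eq, he, auxE, max_eq_left h2.le, min_eq_right h2.le, add_zero]
    exact h1.symm

lemma aux_k_le (hk : IsKernel k) (j : ℤ) : k j ≤ ∑' j, k j :=
  hk.summable.le_tsum j (fun i _ => hk.nonneg i)

lemma aux_K_pos (hk : IsKernel k) : 0 < ∑' j, k j := by
  obtain ⟨i, hi⟩ := hk.nontrivial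
  exact (lt_of_le_of_ne (hk.nonneg i) hi.symm).trans_le (aux_k_le hk i)

lemma aux_W_summable (hk : IsKernel k)
    (hlog : Summable fun j : ℤ => k j * Real.log (2 + 1 / k j)) {l : ℝ} (hl : 0 ≤ l) :
    Summable fun j : ℤ => k j ^ 2 * Hfun (HDinv (l / k j)) := by
  refine ((aux_R_summable hk hlog hl).mul_left l).of_nonneg_of_le
    (fun j => mul_nonneg (sq_nonneg _) (aux_H_nonneg _)) ?_
  intro j
  rcases (hk.nonneg j).eq_or_lt with h | h
  · simp [← h]
  · have := aux_H_tangent 0 (HDinv (l / k j))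
    rw [aux_H_zero, aux_HD_inv] at this
    calc k j ^ 2 * Hfun (HDinv (l / k j)) ≤ k j ^ 2 * (l / k j * HDinv (l / k j)) := by
          gcongr; linarith
      _ = l * (k j * HDinv (l / k j)) := by field_simp

lemma aux_lagrange (hk : IsKernel k)
    (hlog : Summable fun j : ℤ => k j * Real.log (2 + 1 / k j)) {l : ℝ} (hl : 0 ≤ l)
    (s : ℤ → ℝ) (hs : Summable fun j => k j * s j) (hs2 : Summable fun j => k j ^ 2 * Hfun (s j)) :
    auxW k l + l * (∑' j, k j * s j - auxR k l) ≤ ∑' j, k j ^ 2 * Hfun (s j) := by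
  have hR := aux_R_summable hk hlog hl
  have hW := aux_W_summable hk hlog hl
  unfold auxW auxR
  rw [← hs.tsum_sub hR, ← tsum_mul_left, ← hW.tsum_add ((hs.sub hR).mul_left l)]
  refine Summable.tsum_le_tsum ?_ (hW.add ((hs.sub hR).mul_left l)) hs2
  intro j
  rcases (hk.nonneg j).eq_or_lt with h | h
  · simp [← h]
  · have := aux_H_tangent (s j) (HDinv (l / k j))
    rw [aux_HD_inv] at this
    have h2 := mul_le_mul_of_nonneg_left this (sq_nonneg (k j))
    refine le_trans (le_of_eq ?_) h2
    field_simp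

lemma aux_W_zero : auxW k 0 = 0 := by simp [auxW, aux_HDinv_zero, aux_H_zero]

lemma aux_W_asymp (hk : IsKernel k)
    (hlog : Summable fun j : ℤ => k j * Real.log (2 + 1 / k j)) {l : ℝ} (hl : 0 ≤ l) :
    |auxW k l - (∑' j, k j) * l| ≤ 2 * (∑' j, k j) * (∑' j, k j) := by
  have hW := aux_W_summable hk hlog hl
  unfold auxW
  have hd : ∀ j, |k j ^ 2 * Hfun (HDinv (l / k j)) - k j * l| ≤ 2 * (∑' j, k j) * k j := by
    intro j
    rcases (hk.nonneg j).eq_or_lt with h | h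
    · simp [← h]
    · have ht := aux_HDinv_nonneg (div_nonneg hl h.le)
      rw [aux_H_eq, aux_HD_inv]
      set t := HDinv (l / k j)
      have h1 : 0 ≤ t * Real.exp (-t) := by positivity
      have h2 : t * Real.exp (-t) ≤ 1 := by
        have := Real.add_one_le_exp t
        have e2 : Real.exp (-t) * Real.exp t = 1 := by rw [← Real.exp_add]; simp
        have := Real.exp_pos (-t)
        nlinarith
      have e : k j ^ 2 * (l / k j - 2 * (t * Real.exp (-t))) - k j * l
        = -(2 * k j * (k j * (t * Real.exp (-t)))) := by field_simp; ring
      rw [e, abs_neg, abs_of_nonneg (by positivity)]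
      have h3 := aux_k_le hk j
      have hK := (aux_K_pos hk).le
      calc 2 * k j * (k j * (t * Real.exp (-t))) ≤ 2 * k j * ((∑' j, k j) * 1) := by gcongr
        _ = _ := by ring
  rw [← tsum_mul_right, ← hW.tsum_sub (hk.summable.mul_right l), ← Real.norm_eq_abs,
    ← tsum_mul_left]
  exact tsum_of_norm_bounded (hk.summable.mul_left _).hasSum hd

lemma aux_M_summable (hk : IsKernel k)
    (hlog : Summable fun j : ℤ => k j * Real.log (2 + 1 / k j)) :
    Summable fun j : ℤ => k j * Real.log (1 / k j) := by
  refine (hlog.add (hk.summable.mul_right (∑' j, k j))).of_norm_bounded ?_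
  intro j
  rcases (hk.nonneg j).eq_or_lt with h | h
  · simp [← h]
  · rw [← mul_add, Real.norm_eq_abs, abs_mul, abs_of_pos h]
    have h3 := aux_k_le hk j
    refine mul_le_mul_of_nonneg_left ?_ h.le
    have hp : 0 < 1 / k j := by positivity
    have h4 : Real.log (1 / k j) ≤ Real.log (2 + 1 / k j) := Real.log_le_log hp (by linarith)
    have h5 : 0 ≤ Real.log (2 + 1 / k j) := Real.log_nonneg (by linarith)
    have h6 : Real.log (1 / k j) = - Real.log (k j) := by rw [one_div, Real.log_inv]
    have h7 := Real.log_le_sub_one_of_pos h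
    rw [abs_le]
    constructor <;> linarith

lemma aux_E_tendsto (hk : IsKernel k)
    (hlog : Summable fun j : ℤ => k j * Real.log (2 + 1 / k j)) :
    Tendsto (fun l => (∑' j, k j) * Real.log (2 * l) + ∑' j : ℤ, k j * Real.log (1 / k j)
      - auxR k l) atTop (nhds 0) := by
  have hK := aux_K_pos hk
  have hM := aux_M_summable hk hlog
  rw [Metric.tendsto_nhds]
  intro ε hε
  have h1 := (Metric.tendsto_nhds.1 aux_log_tendsto) (ε / 2 / (∑' j, k j)) (by positivity)
  obtain ⟨Y, hY⟩ := eventually_atTop.1 h1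
  filter_upwards [eventually_ge_atTop (Y * ∑' j, k j), eventually_gt_atTop 0] with l hl hl0
  have hR := aux_R_summable hk hlog hl0.le
  rw [dist_zero_right, ← tsum_mul_right, ← (hk.summable.mul_right _).tsum_add hM]
  unfold auxR
  rw [← ((hk.summable.mul_right _).add hM).tsum_sub hR]
  have : ‖∑' j, (k j * Real.log (2 * l) + k j * Real.log (1 / k j) - k j * HDinv (l / k j))‖
      ≤ (ε / 2 / (∑' j, k j)) * ∑' j, k j := by
    refine tsum_of_norm_bounded (hk.summable.hasSum.mul_left _) ?_
    intro j
    rcases (hk.nonneg j).eq_or_lt with h | h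
    · simp [← h]
    · have h2 : Y ≤ l / k j := by
        rw [le_div_iff₀ h]
        rcases le_total 0 Y with hY0 | hY0
        · exact (mul_le_mul_of_nonneg_left (aux_k_le hk j) hY0).trans hl
        · exact (mul_nonpos_of_nonpos_of_nonneg hY0 h.le).trans hl0.le
      have h3 := (hY _ h2).le
      rw [dist_zero_right] at h3
      have e : k j * Real.log (2 * l) + k j * Real.log (1 / k j) - k j * HDinv (l / k j)
          = k j * (Real.log (2 * (l / k j)) - HDinv (l / k j)) := by
        have : 2 * (l / k j) = 2 * l * (1 / k j) := by ring
        rw [this, Real.log_mul (x := 2 * l) (y := 1 / k j) (by positivity) (by positivity)]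
        ring
      rw [e, norm_mul, Real.norm_eq_abs (k j), abs_of_pos h, mul_comm]
      gcongr
  rw [div_mul_cancel₀ _ hK.ne'] at this
  linarith

lemma aux_psi2 (hk : IsKernel k) (u : ℤ → ℝ) (hu : BddFun u) (x : ℤ) :
    ∃ s : ℤ → ℝ, (Summable fun j => k j * s j) ∧ (Summable fun j => k j ^ 2 * Hfun (s j)) ∧
      ∑' j, k j * s j = -Lop k u x ∧ ∑' j, k j ^ 2 * Hfun (s j) ≤ Psi2 k u x := by
  obtain ⟨M, hM⟩ := hu
  have hU0 : ∀ r, 0 ≤ Ups r := fun r => by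
    unfold Ups; have := Real.add_one_le_exp r; linarith
  -- the full double sum
  set f : ℤ × ℤ → ℝ := fun p => k p.1 * k p.2 * Real.exp (u (x + p.2) - u x) *
    Ups (u (x + p.1 + p.2) - u (x + p.1) - u (x + p.2) + u x) with hf
  have hf0 : ∀ p, 0 ≤ f p := fun p =>
    mul_nonneg (mul_nonneg (mul_nonneg (hk.nonneg _) (hk.nonneg _)) (Real.exp_pos _).le) (hU0 _)
  have hfs : Summable f := by
    have h1 : Summable fun p : ℤ × ℤ => k p.1 * k p.2 :=
      hk.summable.mul_of_nonneg hk.summable hk.nonneg hk.nonneg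
    refine (h1.mul_right (Real.exp (2 * M) * (Real.exp (4 * M) + 4 * M))).of_nonneg_of_le hf0 ?_
    intro p
    have a1 := abs_le.1 (hM (x + p.1 + p.2))
    have a2 := abs_le.1 (hM (x + p.1))
    have a3 := abs_le.1 (hM (x + p.2))
    have a4 := abs_le.1 (hM x)
    have hkk : 0 ≤ k p.1 * k p.2 := mul_nonneg (hk.nonneg _) (hk.nonneg _)
    simp only [hf]
    rw [mul_assoc (k p.1 * k p.2)]
    refine mul_le_mul_of_nonneg_left (mul_le_mul ?_ ?_ (hU0 _) (Real.exp_pos _).le) hkk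
    · exact Real.exp_le_exp.2 (by linarith)
    · unfold Ups
      have : Real.exp (u (x + p.1 + p.2) - u (x + p.1) - u (x + p.2) + u x) ≤ Real.exp (4 * M) :=
        Real.exp_le_exp.2 (by linarith)
      linarith
  have hinj : Function.Injective (fun j : ℤ => ((j, -j) : ℤ × ℤ)) := by
    intro a b h; exact (Prod.ext_iff.1 h).1
  have hg : Summable fun j : ℤ => f (j, -j) := hfs.comp_injective hinj
  have hgle : ∑' j : ℤ, f (j, -j) ≤ ∑' p, f p :=
    hg.tsum_le_tsum_of_inj _ hinj (fun c _ => hf0 c) (fun i => le_rfl) hfs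
  have hg' : Summable fun j : ℤ => f (-j, j) := by
    have := (Equiv.neg ℤ).summable_iff.2 hg
    refine this.congr ?_
    intro j; simp
  have hgeq : ∑' j : ℤ, f (-j, j) = ∑' j : ℤ, f (j, -j) := by
    rw [← (Equiv.neg ℤ).tsum_eq (fun j => f (j, -j))]
    simp
  -- summability of the first-order terms
  have hb : Summable fun j : ℤ => k j * (u (x + j) - u x) := by
    refine (hk.summable.mul_right (2 * M)).of_norm_bounded ?_
    intro j
    rw [norm_mul, Real.norm_eq_abs, abs_of_nonneg (hk.nonneg j)]
    refine mul_le_mul_of_nonneg_left ?_ (hk.nonneg j)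
    have a1 := abs_le.1 (hM (x + j))
    have a4 := abs_le.1 (hM x)
    rw [Real.norm_eq_abs, abs_le]
    constructor <;> linarith
  have hb' : Summable fun j : ℤ => k j * (u (x - j) - u x) := by
    have := (Equiv.neg ℤ).summable_iff.2 hb
    refine this.congr ?_
    intro j; simp [hk.symm, sub_eq_add_neg]
  have hbeq : ∑' j : ℤ, k j * (u (x - j) - u x) = Lop k u x := by
    unfold Lop
    rw [← (Equiv.neg ℤ).tsum_eq (fun j => k j * (u (x + j) - u x))]
    simp [hk.symm, sub_eq_add_neg]
  let s : ℤ → ℝ := fun j => -((u (x + j) - u x) + (u (x - j) - u x)) / 2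
  have hse : ∀ j, k j * s j = (-1 / 2) * (k j * (u (x + j) - u x) + k j * (u (x - j) - u x)) := by
    intro j; simp only [s]; ring
  have hpt : ∀ j, k j ^ 2 * Hfun (s j) ≤ (1 / 4) * (f (j, -j) + f (-j, j)) := by
    intro j
    have e1 : f (j, -j) = k j ^ 2 * Real.exp (u (x - j) - u x) * Ups (2 * s j) := by
      simp only [hf, s, hk.symm]
      have h1 : x + j + -j = x := by ring
      have h2 : x + -j = x - j := by ring
      rw [h1, h2, sq]
      congr 2; ring
    have e2 : f (-j, j) = k j ^ 2 * Real.exp (u (x + j) - u x) * Ups (2 * s j) := by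
      simp only [hf, s, hk.symm]
      have h1 : x + -j + j = x := by ring
      have h2 : x + -j = x - j := by ring
      rw [h1, h2, sq]
      congr 2; ring
    have h3 : 2 * Real.exp (-s j) ≤ Real.exp (u (x - j) - u x) + Real.exp (u (x + j) - u x) := by
      have ea : Real.exp (-s j) = Real.exp ((u (x - j) - u x) / 2) * Real.exp ((u (x + j) - u x) / 2) := by
        rw [← Real.exp_add]; congr 1; simp only [s]; ring
      have eb : ∀ r : ℝ, Real.exp r = Real.exp (r / 2) ^ 2 := fun r => by
        rw [sq, ← Real.exp_add]; ring_nf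
      rw [ea, eb (u (x - j) - u x), eb (u (x + j) - u x)]
      have := sq_nonneg (Real.exp ((u (x - j) - u x) / 2) - Real.exp ((u (x + j) - u x) / 2))
      nlinarith
    have h4 : 0 ≤ k j ^ 2 * Ups (2 * s j) := mul_nonneg (sq_nonneg _) (hU0 _)
    rw [e1, e2]
    unfold Hfun
    nlinarith [mul_le_mul_of_nonneg_left h3 h4]
  have hsum : Summable fun j => (1 / 4) * (f (j, -j) + f (-j, j)) := (hg.add hg').mul_left _
  have hs2 : Summable fun j => k j ^ 2 * Hfun (s j) :=
    hsum.of_nonneg_of_le (fun j => mul_nonneg (sq_nonneg _) (aux_H_nonneg _)) hpt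
  refine ⟨s, ?_, hs2, ?_, ?_⟩
  · exact ((hb.add hb').mul_left _).congr fun j => (hse j).symm
  · rw [tsum_congr hse, tsum_mul_left, hb.tsum_add hb', hbeq]
    unfold Lop
    ring
  · refine (hs2.tsum_le_tsum hpt hsum).trans ?_
    rw [tsum_mul_left, hg.tsum_add hg', hgeq]
    unfold Psi2
    linarith

end

/-- Theorem (CD condition from the Lagrange-optimal function): if
`∑_{j∈S} k(j) log(2 + 1/k(j)) < ∞`, then `G` is a strictly convex CD-function, the operator
generated by `k` satisfies `CD_Υ(0,G)`, and
`G(a) ∼ (|k|₁/2) e^{(a − M(k))/|k|₁}` as `a → ∞` where `M(k) = ∑_{j∈S} k(j) log(1/k(j))`. -/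
theorem CD_from_lagrange (k : ℤ → ℝ) (hk : IsKernel k)
    (hlog : Summable fun j : ℤ => k j * Real.log (2 + 1 / k j)) :
    IsCDFunction (Gfun k) ∧ CDUps k (Gfun k) ∧ StrictConvexOn ℝ (Ici 0) (Gfun k) ∧
      Tendsto (fun a => Gfun k a /
          (((∑' j : ℤ, k j) / 2) *
            Real.exp ((a - ∑' j : ℤ, k j * Real.log (1 / k j)) / (∑' j : ℤ, k j))))
        atTop (nhds 1) := by
  obtain ⟨lp, hc, hnn, hR, hneg, hmono, htop, hinv⟩ := aux_lam_exists hk hlog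
  have hK := aux_K_pos hk
  set K := ∑' j : ℤ, k j with hKdef
  set M := ∑' j : ℤ, k j * Real.log (1 / k j) with hMdef
  -- the value function and its derivative
  let V : ℝ → ℝ := fun a => auxW k (lp a)
  have hsub : ∀ a b, V a + lp a * (b - a) ≤ V b := by
    intro a b
    have h := aux_lagrange hk hlog (hnn a) (fun j => HDinv (lp b / k j))
      (aux_R_summable hk hlog (hnn b)) (aux_W_summable hk hlog (hnn b))
    have h1 : ∑' j, k j * HDinv (lp b / k j) = max b 0 := hR b
    rw [h1, hR a] at h
    have h2 : lp a * (b - a) ≤ lp a * (max b 0 - max a 0) := by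
      rcases le_total a 0 with ha | ha
      · rw [hneg a ha]; simp
      · refine mul_le_mul_of_nonneg_left ?_ (hnn a)
        rw [max_eq_left ha]
        have := le_max_left b 0
        linarith
    exact (add_le_add_right h2 _).trans h
  have hV : ∀ a, HasDerivAt V (lp a) a := aux_deriv_of_subgrad hc hsub
  have hVc : Continuous V := continuous_iff_continuousAt.2 fun a => (hV a).continuousAt
  have hV0 : V 0 = 0 := by
    show auxW k (lp 0) = 0
    rw [hneg 0 le_rfl, aux_W_zero]
  have hG : ∀ a, 0 ≤ a → Gfun k a = V a := by
    intro a ha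
    unfold Gfun
    have h1 : ∫ s in (0:ℝ)..a, rhoInv k s = ∫ s in (0:ℝ)..a, lp s := by
      apply intervalIntegral.integral_congr_ae
      refine Filter.Eventually.of_forall fun s hs => ?_
      rw [uIoc_of_le ha] at hs
      exact hinv s hs.1
    rw [h1, intervalIntegral.integral_eq_sub_of_hasDerivAt (fun s _ => hV s)
      (hc.intervalIntegrable _ _), hV0, sub_zero]
  have hVnn : ∀ a, 0 ≤ V a := fun a =>
    tsum_nonneg fun j => mul_nonneg (sq_nonneg _) (aux_H_nonneg _)
  have hVconv : StrictConvexOn ℝ (Ici 0) V := by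
    apply StrictMonoOn.strictConvexOn_of_deriv (convex_Ici 0) hVc.continuousOn
    have : deriv V = lp := funext fun a => (hV a).deriv
    rw [this, interior_Ici]
    exact hmono.mono Ioi_subset_Ici_self
  have hGconv : StrictConvexOn ℝ (Ici 0) (Gfun k) := by
    refine ⟨convex_Ici 0, ?_⟩
    intro x hx y hy hxy a b ha hb hab
    rw [hG x hx, hG y hy, hG _ (convex_Ici (0:ℝ) hx hy ha.le hb.le hab)]
    exact hVconv.2 hx hy hxy ha hb hab
  -- asymptotics
  have hlim : Tendsto (fun a => Gfun k a / ((K / 2) * Real.exp ((a - M) / K)))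
      atTop (nhds 1) := by
    have h1 : Tendsto (fun a => auxW k (lp a) / (K * lp a)) atTop (nhds 1) := by
      have h2 : Tendsto (fun l => auxW k l / (K * l)) atTop (nhds 1) := by
        have h3 : Tendsto (fun l : ℝ => 2 * K / l) atTop (nhds 0) :=
          tendsto_const_nhds.div_atTop tendsto_id
        rw [tendsto_iff_norm_sub_tendsto_zero]
        refine squeeze_zero' (Filter.Eventually.of_forall fun _ => norm_nonneg _) ?_ h3
        filter_upwards [eventually_gt_atTop 0] with l hl
        have h4 := aux_W_asymp hk hlog hl.le
        have e : auxW k l / (K * l) - 1 = (auxW k l - K * l) / (K * l) := by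
          field_simp
        rw [e, norm_div, Real.norm_eq_abs, Real.norm_eq_abs, abs_of_pos (mul_pos hK hl),
          div_le_div_iff₀ (mul_pos hK hl) hl]
        calc _ ≤ 2 * K * K * l := by gcongr
          _ = _ := by ring
      exact h2.comp htop
    have h5 : Tendsto (fun a => Real.exp ((K * Real.log (2 * lp a) + M - auxR k (lp a)) / K))
        atTop (nhds 1) := by
      have := ((aux_E_tendsto hk hlog).comp htop).div_const K
      rw [zero_div] at this
      have h6 := (Real.continuous_exp.tendsto 0).comp this
      rw [Real.exp_zero] at h6
      exact h6
    have h7 := h1.mul h5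
    rw [one_mul] at h7
    refine h7.congr' ?_
    filter_upwards [eventually_ge_atTop 0, htop.eventually_gt_atTop 0] with a ha hl
    rw [hG a ha, hR a, max_eq_left ha]
    have e : (K * Real.log (2 * lp a) + M - a) / K = Real.log (2 * lp a) - (a - M) / K := by
      field_simp; ring
    rw [e, Real.exp_sub, Real.exp_log (by positivity)]
    show auxW k (lp a) / _ * _ = auxW k (lp a) / _
    have := Real.exp_pos ((a - M) / K)
    field_simp
  refine ⟨⟨?_, ?_, ?_, ?_, ?_⟩, ?_, hGconv, hlim⟩
  · exact hVc.continuousOn.congr fun a ha => hG a ha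
  · intro r hr; rw [hG r hr]; exact hVnn r
  · rw [hG 0 le_rfl, hV0]
  · intro a ha b hb hab
    have ha' : (0:ℝ) < a := ha
    have hb' : (0:ℝ) < b := hb
    have := hVconv.secant_strict_mono (a := 0) (x := a) (y := b) (mem_Ici.2 le_rfl)
      (mem_Ici.2 ha'.le) (mem_Ici.2 hb'.le) ha'.ne' hb'.ne' hab
    simp only [hV0, sub_zero] at this
    simp only [hG a ha'.le, hG b hb'.le]
    exact this
  · have h1 : ∀ᶠ a in atTop, (1 / 2 : ℝ) < Gfun k a / ((K / 2) * Real.exp ((a - M) / K)) :=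
      hlim.eventually_const_lt (by norm_num)
    obtain ⟨A, hA⟩ := eventually_atTop.1 h1
    have hlow : ∀ a, A ≤ a → (K / 4) * Real.exp ((a - M) / K) < Gfun k a := by
      intro a ha
      have := hA a ha
      rw [lt_div_iff₀ (by positivity)] at this
      linarith
    refine ⟨max A 1, by positivity, ?_⟩
    rw [integrableOn_Ici_iff_integrableOn_Ioi]
    refine integrable_of_isBigO_exp_neg (b := 1 / K) (by positivity) ?_ ?_
    · apply ContinuousOn.div continuousOn_const
      · refine hVc.continuousOn.congr fun a ha => hG a ?_
        exact zero_le_one.trans ((le_max_right A 1).trans ha)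
      · intro a ha
        have h2 := hlow a ((le_max_left A 1).trans ha)
        have : 0 < (K / 4) * Real.exp ((a - M) / K) := by positivity
        linarith
    · refine Asymptotics.IsBigO.of_bound (4 / K * Real.exp (M / K)) ?_
      filter_upwards [eventually_ge_atTop A] with a ha
      have h2 := hlow a ha
      have h3 : 0 < (K / 4) * Real.exp ((a - M) / K) := by positivity
      rw [Real.norm_eq_abs, Real.norm_eq_abs, Real.abs_exp, abs_of_pos (by
        exact one_div_pos.2 (h3.trans h2))]
      refine (one_div_le_one_div_of_le h3 h2.le).trans (le_of_eq ?_)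
      have e : (a - M) / K = -(M / K) - (-(1 / K) * a) := by field_simp; ring
      rw [e, Real.exp_sub, Real.exp_neg]
      have := Real.exp_pos (-(1 / K) * a)
      have := Real.exp_pos (M / K)
      field_simp
  · intro u hu x hx
    obtain ⟨s, hs, hs2, hsL, hle⟩ := aux_psi2 hk u hu x
    rw [hG _ hx]
    have h := aux_lagrange hk hlog (hnn (-Lop k u x)) s hs hs2
    rw [hsL, hR, max_eq_left hx, sub_self, mul_zero, add_zero] at h
    exact h.trans hle
end
end

section
/- Let β > 0 and let L_β be the operator on ℤ generated by the power-type kernel k_β(j) = |j|^{−(1+β)} for j ≠ 0, k_β(0) = 0. Then there exist a strictly convex CD-function G_β and a constant c > 0 such that: (1) L_β satisfies CD_Υ(0,G_β); (2) G_β(r) / ( (|k_β|₁/2) · e^{(r − M(k_β))/|k_β|₁} ) → 1 as r → ∞, where |k_β|₁ = ∑_{j∈ℤ} k_β(j) and M(k_β) = ∑_{j≠0} k_β(j) log(1/k_β(j)); (3) G_β(r) ≥ c·r^{(1+2β)/β} for all r ≥ 0. -/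
open scoped BigOperators
open Filter Set

noncomputable section

/-- The power-type kernel `k_β(j) = |j|^{−(1+β)}` for `j ≠ 0`, `k_β(0) = 0`. -/
def kpow (β : ℝ) (j : ℤ) : ℝ := if j = 0 then 0 else |(j : ℝ)| ^ (-(1 + β))


def hf (x : ℝ) : ℝ := (Real.exp x - Real.exp (-x) + 2 * x * Real.exp (-x)) / 2

lemma Hfun_eq (x : ℝ) :
    Hfun x = (Real.exp x - Real.exp (-x) - 2 * x * Real.exp (-x)) / 2 := by
  unfold Hfun Ups
  have : Real.exp (-x) * Real.exp (2 * x) = Real.exp x := by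
    rw [← Real.exp_add]; congr 1; ring
  linear_combination (1/2) * this

lemma hasDerivAt_expneg (x : ℝ) : HasDerivAt (fun x : ℝ => Real.exp (-x)) (-Real.exp (-x)) x := by
  have := (hasDerivAt_neg x).exp
  simpa using this

lemma hasDerivAt_H (x : ℝ) : HasDerivAt Hfun (hf x) x := by
  have h1 := Real.hasDerivAt_exp x
  have h2 := hasDerivAt_expneg x
  have h3 := ((hasDerivAt_id x).const_mul 2).mul h2
  have h := ((h1.sub h2).sub h3).div_const 2
  have he : Hfun = fun x => (Real.exp x - Real.exp (-x) - 2 * x * Real.exp (-x)) / 2 :=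
    funext Hfun_eq
  rw [he]
  refine h.congr_deriv ?_
  unfold hf
  simp
  ring

lemma hasDerivAt_h (x : ℝ) :
    HasDerivAt hf ((Real.exp x + (3 - 2 * x) * Real.exp (-x)) / 2) x := by
  have h1 := Real.hasDerivAt_exp x
  have h2 := hasDerivAt_expneg x
  have h3 := ((hasDerivAt_id x).const_mul 2).mul h2
  have h := ((h1.sub h2).add h3).div_const 2
  refine h.congr_deriv ?_
  simp
  ring

lemma hf_strictMono : StrictMono hf := by
  apply strictMono_of_deriv_pos
  intro x
  rw [(hasDerivAt_h x).deriv]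
  have e1 : Real.exp x = Real.exp (-x) * Real.exp (2 * x) := by
    rw [← Real.exp_add]; congr 1; ring
  have e2 := Real.add_one_le_exp (2 * x)
  have e3 := Real.exp_pos (-x)
  rw [e1]
  nlinarith

lemma hf_cont : Continuous hf := by
  unfold hf; fun_prop

lemma Hfun_cont : Continuous Hfun := by
  unfold Hfun Ups; fun_prop

lemma H_strictConvex : StrictConvexOn ℝ univ Hfun := by
  apply StrictMono.strictConvexOn_univ_of_deriv Hfun_cont
  have : deriv Hfun = hf := funext fun x => (hasDerivAt_H x).deriv
  rw [this]; exact hf_strictMono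

lemma tangent_lt {x y : ℝ} (hxy : x ≠ y) : Hfun y + hf y * (x - y) < Hfun x := by
  rcases lt_or_gt_of_ne hxy with h | h
  · have := H_strictConvex.slope_lt_of_hasDerivAt (mem_univ x) (mem_univ y) h (hasDerivAt_H y)
    rw [slope_def_field, div_lt_iff₀ (by linarith)] at this
    linarith
  · have := H_strictConvex.lt_slope_of_hasDerivAt (mem_univ y) (mem_univ x) h (hasDerivAt_H y)
    rw [slope_def_field, lt_div_iff₀ (by linarith)] at this
    linarith

lemma tangent_le (x y : ℝ) : Hfun y + hf y * (x - y) ≤ Hfun x := by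
  by_cases h : x = y
  · subst h; simp
  · exact (tangent_lt h).le

lemma hf_lb {x : ℝ} (hx : 0 ≤ x) : Real.exp x - 1 ≤ 2 * hf x := by
  unfold hf
  have : Real.exp (-x) ≤ 1 := Real.exp_le_one_iff.2 (by linarith)
  have h2 := mul_nonneg hx (Real.exp_pos (-x)).le
  linarith

lemma two_x_exp {x : ℝ} : 2 * x * Real.exp (-x) ≤ 3 / 4 := by
  have h1 := Real.add_one_le_exp (x - 1)
  have h2 : Real.exp (x - 1) * Real.exp (-x) = Real.exp (-1) := by
    rw [← Real.exp_add]; congr 1; ring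
  have h3 : Real.exp (-1) < 0.37 := Real.exp_neg_one_lt_d9.trans (by norm_num)
  have h4 := mul_le_mul_of_nonneg_right h1 (Real.exp_pos (-x)).le
  rw [h2] at h4
  norm_num at h3
  linarith

lemma hf_ub {x : ℝ} : 2 * hf x ≤ Real.exp x + 1 := by
  unfold hf
  have h2 := two_x_exp (x := x)
  have := Real.exp_pos (-x)
  linarith

lemma H_eq_h (x : ℝ) : Hfun x = hf x - 2 * x * Real.exp (-x) := by
  rw [Hfun_eq]; unfold hf; ring

lemma Hfun_nonneg (x : ℝ) : 0 ≤ Hfun x := by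
  unfold Hfun Ups
  have := Real.add_one_le_exp (2 * x)
  have h : 0 ≤ Real.exp (2 * x) - 1 - 2 * x := by linarith
  positivity

lemma hf_zero : hf 0 = 0 := by simp [hf]

lemma H_le_h {x : ℝ} (hx : 0 ≤ x) : Hfun x ≤ hf x := by
  rw [H_eq_h]
  have := mul_nonneg hx (Real.exp_pos (-x)).le
  linarith

lemma H_ge_lin {x : ℝ} (h : 1 ≤ hf x) : hf x / 4 ≤ Hfun x := by
  rw [H_eq_h]; have := two_x_exp (x := x); linarith

lemma H_ge_sq {x : ℝ} (hx : 0 ≤ x) (h : hf x ≤ 1) : hf x ^ 2 / 27 ≤ Hfun x := by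
  have h1 : Real.exp x ≤ 3 := by have := hf_lb hx; linarith
  have h2 : Real.exp x * Real.exp (-x) = 1 := by rw [← Real.exp_add]; simp
  have hp := Real.exp_pos (-x)
  have h3 : 1 / 3 ≤ Real.exp (-x) := by nlinarith
  have h4 : Real.exp (-x) ≤ 1 := Real.exp_le_one_iff.2 (by linarith)
  have h5 := Real.quadratic_le_exp_of_nonneg (x := 2 * x) (by linarith)
  have h6 := Real.add_one_le_exp (-x)
  have h7 : hf x ≤ 3 * x := by
    unfold hf
    nlinarith
  have h0 : 0 ≤ hf x := by rw [← hf_zero]; exact hf_strictMono.monotone hx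
  have h8 : x ^ 2 / 3 ≤ Hfun x := by
    unfold Hfun Ups
    nlinarith [sq_nonneg x]
  nlinarith

lemma phi_ex (m : ℝ) (hm : 0 ≤ m) : ∃ x : ℝ, 0 ≤ x ∧ hf x = m := by
  have h1 : m ∈ Icc (hf 0) (hf (2 * m)) := by
    refine ⟨by rw [hf_zero]; exact hm, ?_⟩
    have := hf_lb (x := 2 * m) (by linarith)
    have := Real.add_one_le_exp (2 * m)
    linarith
  obtain ⟨x, hx, hx2⟩ := intermediate_value_Icc (by linarith) hf_cont.continuousOn h1
  exact ⟨x, hx.1, hx2⟩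

open Classical in
def phi (m : ℝ) : ℝ := if h : 0 ≤ m then (phi_ex m h).choose else 0

lemma phi_nonneg (m : ℝ) : 0 ≤ phi m := by
  unfold phi; split_ifs with h
  · exact (phi_ex m h).choose_spec.1
  · exact le_rfl

lemma h_phi {m : ℝ} (h : 0 ≤ m) : hf (phi m) = m := by
  unfold phi; rw [dif_pos h]; exact (phi_ex m h).choose_spec.2

lemma phi_zero : phi 0 = 0 := by
  apply hf_strictMono.injective
  rw [h_phi le_rfl, hf_zero]

lemma phi_h {x : ℝ} (hx : 0 ≤ x) : phi (hf x) = x := by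
  apply hf_strictMono.injective
  apply h_phi
  rw [← hf_zero]; exact hf_strictMono.monotone hx

lemma phi_lt {a b : ℝ} (ha : 0 ≤ a) (hab : a < b) : phi a < phi b := by
  rw [← hf_strictMono.lt_iff_lt, h_phi ha, h_phi (ha.trans hab.le)]; exact hab

lemma phi_le {a b : ℝ} (ha : 0 ≤ a) (hab : a ≤ b) : phi a ≤ phi b := by
  rw [← hf_strictMono.le_iff_le, h_phi ha, h_phi (ha.trans hab)]; exact hab

lemma exp_phi_le {m : ℝ} (hm : 0 ≤ m) : Real.exp (phi m) ≤ 1 + 2 * m := by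
  have := hf_lb (phi_nonneg m); rw [h_phi hm] at this; linarith

lemma le_exp_phi {m : ℝ} (hm : 0 ≤ m) : 2 * m - 1 ≤ Real.exp (phi m) := by
  have := hf_ub (x := phi m); rw [h_phi hm] at this; linarith

lemma phi_le_two {m : ℝ} (hm : 0 ≤ m) : phi m ≤ 2 * m := by
  have := exp_phi_le hm
  have := Real.add_one_le_exp (phi m)
  linarith

lemma phi_le_rpow {m e : ℝ} (hm : 0 ≤ m) (he : 0 < e) (he1 : e ≤ 1) :
    phi m ≤ 2 / e * m ^ e := by
  have h1 : phi m ≤ Real.log (1 + 2 * m) := by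
    rw [Real.le_log_iff_exp_le (by linarith)]; exact exp_phi_le hm
  have h2 : Real.log ((1 + 2 * m) ^ e) ≤ (1 + 2 * m) ^ e - 1 :=
    Real.log_le_sub_one_of_pos (by positivity)
  rw [Real.log_rpow (by linarith)] at h2
  have h3 : (1 + 2 * m) ^ e ≤ 1 ^ e + (2 * m) ^ e :=
    Real.rpow_add_le_add_rpow (by norm_num) (by linarith) he.le he1
  rw [Real.one_rpow, Real.mul_rpow (by norm_num) hm] at h3
  have h4 : (2 : ℝ) ^ e ≤ 2 := by
    calc (2 : ℝ) ^ e ≤ 2 ^ (1 : ℝ) := Real.rpow_le_rpow_of_exponent_le (by norm_num) he1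
      _ = 2 := by simp
  have h5 : 0 ≤ m ^ e := by positivity
  rw [div_mul_eq_mul_div, le_div_iff₀ he]
  nlinarith

lemma phi_contOn : ContinuousOn phi (Ici 0) := by
  have hm : StrictMonoOn phi (Ici 0) := fun a ha b _ hab => phi_lt ha hab
  intro a ha
  have himg : phi '' Ici 0 = Ici 0 := by
    ext y; constructor
    · rintro ⟨x, _, rfl⟩; exact phi_nonneg x
    · intro hy
      refine ⟨hf y, ?_, phi_h hy⟩
      show 0 ≤ hf y
      rw [← hf_zero]; exact hf_strictMono.monotone hy
  rcases (show (0:ℝ) ≤ a from ha).eq_or_lt with h | h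
  · subst h
    have h2 : Tendsto (fun m : ℝ => 2 * m) (nhdsWithin 0 (Ici 0)) (nhds 0) := by
      have : Continuous (fun m : ℝ => 2 * m) := by fun_prop
      simpa using (this.tendsto 0).mono_left nhdsWithin_le_nhds
    show Tendsto phi _ _
    rw [phi_zero]
    refine tendsto_of_tendsto_of_tendsto_of_le_of_le' tendsto_const_nhds h2 ?_ ?_
    · exact Eventually.of_forall phi_nonneg
    · filter_upwards [self_mem_nhdsWithin] with m hm using phi_le_two hm
  · apply ContinuousAt.continuousWithinAt
    apply hm.continuousAt_of_image_mem_nhds (Ici_mem_nhds h)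
    rw [himg]
    apply Ici_mem_nhds
    have := phi_lt le_rfl h
    rwa [phi_zero] at this

structure Good (k : ℤ → ℝ) : Prop where
  nn : ∀ j, 0 ≤ k j
  sy : ∀ j, k (-j) = k j
  sm : Summable k
  le1 : ∀ j, k j ≤ 1
  one : k 1 = 1
  sphi : ∀ l, 0 ≤ l → Summable fun j => k j * phi (l / k j)

def Sf (k : ℤ → ℝ) (l : ℝ) : ℝ := ∑' j, k j * phi (l / k j)
def Ef (k : ℤ → ℝ) (l : ℝ) : ℝ := ∑' j, k j ^ 2 * Hfun (phi (l / k j))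

lemma ksq {k : ℤ → ℝ} (l : ℝ) (j : ℤ) : k j ^ 2 * (l / k j) = l * k j := by
  by_cases h : k j = 0
  · simp [h]
  · field_simp

lemma Good.sE {k : ℤ → ℝ} (g : Good k) {l : ℝ} (hl : 0 ≤ l) :
    Summable fun j => k j ^ 2 * Hfun (phi (l / k j)) := by
  refine Summable.of_nonneg_of_le (fun j => mul_nonneg (sq_nonneg _) (Hfun_nonneg _)) (fun j => ?_)
    (g.sm.mul_left l)
  have h := H_le_h (phi_nonneg (l / k j))
  rw [h_phi (div_nonneg hl (g.nn j))] at h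
  rw [← ksq]
  exact mul_le_mul_of_nonneg_left h (sq_nonneg _)

lemma Good.ssq {k : ℤ → ℝ} (g : Good k) : Summable fun j => k j ^ 2 := by
  refine Summable.of_nonneg_of_le (fun j => sq_nonneg _) (fun j => ?_) g.sm
  have := g.le1 j; have := g.nn j; nlinarith

lemma tangent_k {k : ℤ → ℝ} (g : Good k) {l : ℝ} (hl : 0 ≤ l) (j : ℤ) (x : ℝ) :
    k j ^ 2 * Hfun (phi (l / k j)) + l * (k j * x - k j * phi (l / k j)) ≤ k j ^ 2 * Hfun x := by
  have h := tangent_le x (phi (l / k j))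
  rw [h_phi (div_nonneg hl (g.nn j))] at h
  have h2 := mul_le_mul_of_nonneg_left h (sq_nonneg (k j))
  have h3 := ksq (k := k) l j
  calc _ = k j ^ 2 * Hfun (phi (l / k j)) + (l * k j) * (x - phi (l / k j)) := by ring
    _ = k j ^ 2 * (Hfun (phi (l / k j)) + l / k j * (x - phi (l / k j))) := by rw [← h3]; ring
    _ ≤ _ := h2

lemma Good.hasSum_lin {k : ℤ → ℝ} (g : Good k) {l : ℝ} (hl : 0 ≤ l) {x : ℤ → ℝ}
    (hx : Summable fun j => k j * x j) :
    HasSum (fun j => k j ^ 2 * Hfun (phi (l / k j)) + l * (k j * x j - k j * phi (l / k j)))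
      (Ef k l + l * ((∑' j, k j * x j) - Sf k l)) :=
  (g.sE hl).hasSum.add ((hx.hasSum.sub (g.sphi l hl).hasSum).mul_left l)

lemma Good.support {k : ℤ → ℝ} (g : Good k) {l m : ℝ} (hl : 0 ≤ l) (hm : 0 ≤ m) (h : l ≠ m) :
    Ef k l + l * (Sf k m - Sf k l) < Ef k m := by
  have h1 := g.hasSum_lin hl (g.sphi m hm)
  refine hasSum_lt (i := 1) (fun j => tangent_k g hl j _) ?_ h1 (g.sE hm).hasSum
  simp only [g.one, div_one, one_pow, one_mul]
  have hne : phi m ≠ phi l := by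
    rcases lt_or_gt_of_ne h with h | h
    · exact (phi_lt hl h).ne'
    · exact (phi_lt hm h).ne
  have := tangent_lt hne
  rwa [h_phi hl] at this

lemma Good.S_lt {k : ℤ → ℝ} (g : Good k) {a b : ℝ} (ha : 0 ≤ a) (hab : a < b) :
    Sf k a < Sf k b := by
  refine Summable.tsum_lt_tsum (i := 1) (fun j => ?_) ?_ (g.sphi a ha) (g.sphi b (ha.trans hab.le))
  · exact mul_le_mul_of_nonneg_left (phi_le (div_nonneg ha (g.nn j))
      (div_le_div_of_nonneg_right hab.le (g.nn j))) (g.nn j)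
  · simp only [g.one, div_one, one_mul]; exact phi_lt ha hab

lemma Sf_zero (k : ℤ → ℝ) : Sf k 0 = 0 := by
  simp [Sf, phi_zero]

lemma Ef_zero (k : ℤ → ℝ) : Ef k 0 = 0 := by
  simp [Ef, phi_zero, Hfun, Ups]

lemma Good.S_contOn {k : ℤ → ℝ} (g : Good k) (B : ℝ) (hB : 0 ≤ B) :
    ContinuousOn (Sf k) (Icc 0 B) := by
  refine continuousOn_tsum (fun j => ?_) (g.sphi B hB) (fun j x hx => ?_)
  · refine continuousOn_const.mul ?_
    refine phi_contOn.comp (by fun_prop) (fun x hx => ?_)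
    exact div_nonneg hx.1 (g.nn j)
  · rw [Real.norm_of_nonneg (mul_nonneg (g.nn j) (phi_nonneg _))]
    exact mul_le_mul_of_nonneg_left (phi_le (div_nonneg hx.1 (g.nn j))
      (div_le_div_of_nonneg_right hx.2 (g.nn j))) (g.nn j)

lemma Good.S_ge {k : ℤ → ℝ} (g : Good k) {l : ℝ} (hl : 0 ≤ l) : phi l ≤ Sf k l := by
  have := (g.sphi l hl).le_tsum 1 (fun j _ => mul_nonneg (g.nn j) (phi_nonneg _))
  simpa [g.one, Sf] using this

lemma Good.S_surj {k : ℤ → ℝ} (g : Good k) (r : ℝ) (hr : 0 ≤ r) : ∃ l, 0 ≤ l ∧ Sf k l = r := by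
  have h0 : 0 ≤ hf r := by rw [← hf_zero]; exact hf_strictMono.monotone hr
  have h1 : r ∈ Icc (Sf k 0) (Sf k (hf r)) := by
    refine ⟨by rw [Sf_zero]; exact hr, ?_⟩
    have := g.S_ge h0
    rwa [phi_h hr] at this
  obtain ⟨x, hx, hx2⟩ := intermediate_value_Icc h0 (g.S_contOn _ h0) h1
  exact ⟨x, hx.1, hx2⟩

open Classical in
def Lam (k : ℤ → ℝ) (r : ℝ) : ℝ :=
  if h : ∃ l, 0 ≤ l ∧ Sf k l = r then h.choose else 0

lemma Lam_nonneg (k : ℤ → ℝ) (r : ℝ) : 0 ≤ Lam k r := by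
  unfold Lam; split_ifs with h
  · exact h.choose_spec.1
  · exact le_rfl

lemma Good.S_Lam {k : ℤ → ℝ} (g : Good k) {r : ℝ} (hr : 0 ≤ r) : Sf k (Lam k r) = r := by
  have h := g.S_surj r hr
  unfold Lam; rw [dif_pos h]; exact h.choose_spec.2

def Gf (k : ℤ → ℝ) (r : ℝ) : ℝ := Ef k (Lam k r)

lemma Good.Lam_le {k : ℤ → ℝ} (g : Good k) {r s : ℝ} (hr : 0 ≤ r) (h : r ≤ s) :
    Lam k r ≤ Lam k s := by
  by_contra hc
  push Not at hc
  have := g.S_lt (Lam_nonneg k s) hc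
  rw [g.S_Lam hr, g.S_Lam (hr.trans h)] at this
  linarith

lemma Good.Lam_tendsto {k : ℤ → ℝ} (g : Good k) : Tendsto (Lam k) atTop atTop := by
  rw [tendsto_atTop]
  intro b
  have hB : 0 ≤ max b 0 := le_max_right _ _
  have h0 : 0 ≤ Sf k (max b 0) := (phi_nonneg _).trans (g.S_ge hB)
  filter_upwards [eventually_ge_atTop (Sf k (max b 0))] with r hr
  by_contra hc
  push Not at hc
  have := g.S_lt (Lam_nonneg k r) (hc.trans_le (le_max_left _ 0))
  rw [g.S_Lam (h0.trans hr)] at this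
  linarith

lemma Good.G_support {k : ℤ → ℝ} (g : Good k) {r s : ℝ} (hr : 0 ≤ r) (hs : 0 ≤ s) (h : r ≠ s) :
    Gf k r + Lam k r * (s - r) < Gf k s := by
  have hne : Lam k r ≠ Lam k s := fun he => h (by rw [← g.S_Lam hr, ← g.S_Lam hs, he])
  have := g.support (Lam_nonneg k r) (Lam_nonneg k s) hne
  rwa [g.S_Lam hr, g.S_Lam hs] at this

lemma Good.G_zero {k : ℤ → ℝ} (g : Good k) : Gf k 0 = 0 := by
  have : Lam k 0 = 0 := by
    by_contra hc
    have h1 := lt_of_le_of_ne (Lam_nonneg k 0) (Ne.symm hc)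
    have := g.S_lt le_rfl h1
    rw [g.S_Lam le_rfl, Sf_zero] at this
    exact lt_irrefl _ this
  rw [Gf, this, Ef_zero]

lemma Gf_nonneg (k : ℤ → ℝ) (r : ℝ) : 0 ≤ Gf k r :=
  tsum_nonneg fun _ => mul_nonneg (sq_nonneg _) (Hfun_nonneg _)

lemma Good.G_sconv {k : ℤ → ℝ} (g : Good k) : StrictConvexOn ℝ (Ici 0) (Gf k) := by
  refine ⟨convex_Ici 0, ?_⟩
  intro x hx y hy hxy a b ha hb hab
  have hx : 0 ≤ x := hx
  have hy : 0 ≤ y := hy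
  simp only [smul_eq_mul]
  have hz : 0 ≤ a * x + b * y := by positivity
  have hbe : b = 1 - a := by linarith
  have h1 := g.G_support hz hx (by
    intro h; apply hxy
    have : b * (y - x) = 0 := by rw [hbe] at h ⊢; linarith
    rcases mul_eq_zero.1 this with h | h <;> linarith)
  have h2 := g.G_support hz hy (by
    intro h; apply hxy
    have : a * (x - y) = 0 := by rw [hbe] at h; linarith
    rcases mul_eq_zero.1 this with h | h <;> linarith)
  have h3 := add_lt_add (mul_lt_mul_of_pos_left h1 ha) (mul_lt_mul_of_pos_left h2 hb)
  refine lt_of_eq_of_lt ?_ h3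
  rw [hbe]; ring

lemma Good.G_cont {k : ℤ → ℝ} (g : Good k) : ContinuousOn (Gf k) (Ici 0) := by
  intro r hr
  rcases (show (0:ℝ) ≤ r from hr).eq_or_lt with h | h
  · subst h
    show Tendsto (Gf k) _ _
    rw [g.G_zero]
    have h2 : Tendsto (fun m : ℝ => Lam k 1 * m) (nhdsWithin 0 (Ici 0)) (nhds 0) := by
      have : Continuous (fun m : ℝ => Lam k 1 * m) := by fun_prop
      simpa using (this.tendsto 0).mono_left nhdsWithin_le_nhds
    refine tendsto_of_tendsto_of_tendsto_of_le_of_le' tendsto_const_nhds h2 ?_ ?_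
    · exact Eventually.of_forall (Gf_nonneg k)
    · have h1 : ∀ᶠ m : ℝ in nhdsWithin 0 (Ici 0), m < 1 :=
        nhdsWithin_le_nhds (Iio_mem_nhds one_pos)
      filter_upwards [self_mem_nhdsWithin, h1] with m hm hm1
      have hm : 0 ≤ m := hm
      have hl := g.Lam_le hm hm1.le
      by_cases h0 : m = 0
      · subst h0; simp [g.G_zero]
      · have := g.G_support hm le_rfl h0
        rw [g.G_zero] at this
        have := mul_le_mul_of_nonneg_right hl hm
        linarith
  · have := g.G_sconv.convexOn.continuousOn_interior
    rw [interior_Ici] at this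
    exact (this.continuousAt (Ioi_mem_nhds h)).continuousWithinAt

lemma Good.G_div {k : ℤ → ℝ} (g : Good k) : StrictMonoOn (fun r => Gf k r / r) (Ioi 0) := by
  intro x hx y hy hxy
  have hx : 0 < x := hx
  have hy : 0 < y := hy
  have h := g.G_sconv.secant_strict_mono (a := 0) (x := x) (y := y) (by simp)
    hx.le hy.le hx.ne' hy.ne' hxy
  simpa [g.G_zero] using h

lemma Good.CD {k : ℤ → ℝ} (g : Good k) : CDUps k (Gf k) := by
  intro u ⟨M, hM⟩ x hr
  set r := -Lop k u x with hrdef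
  set l := Lam k r
  have hl : 0 ≤ l := Lam_nonneg k r
  have hSl : Sf k l = r := g.S_Lam hr
  have hM0 : 0 ≤ M := (abs_nonneg _).trans (hM 0)
  have hb : ∀ y, -M ≤ u y ∧ u y ≤ M := fun y => abs_le.1 (hM y)
  have s1 : Summable fun j => k j * (u (x + j) - u x) := by
    refine Summable.of_norm_bounded (g.sm.mul_left (2 * M)) (fun j => ?_)
    rw [Real.norm_eq_abs, abs_mul, abs_of_nonneg (g.nn j), mul_comm]
    refine mul_le_mul_of_nonneg_right ?_ (g.nn j)
    rw [abs_le]; have := hb (x + j); have := hb x; constructor <;> linarith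
  have H1 : HasSum (fun j => k j * (u (x + j) - u x)) (-r) := by
    have := s1.hasSum; rw [hrdef, neg_neg]; exact this
  have H2 : HasSum (fun j => k j * (u (x - j) - u x)) (-r) := by
    have := (Equiv.neg ℤ).hasSum_iff.2 H1
    refine this.congr_fun ?_ |> id
    intro j; simp [g.sy, sub_eq_add_neg]
  set X : ℤ → ℝ := fun j => -((u (x + j) - u x) + (u (x - j) - u x)) / 2
  have H3 : HasSum (fun j => k j * X j) r := by
    have := (H1.add H2).mul_left (-1 / 2)
    have e1 : (fun j => k j * X j) = fun j =>
        -1 / 2 * (k j * (u (x + j) - u x) + k j * (u (x - j) - u x)) := by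
      funext j; simp only [X]; ring
    have e2 : r = -1 / 2 * (-r + -r) := by ring
    rw [e1, e2]; exact this
  set T : ℤ × ℤ → ℝ := fun p => k p.1 * k p.2 * Real.exp (u (x + p.2) - u x) *
    Ups (u (x + p.1 + p.2) - u (x + p.1) - u (x + p.2) + u x) with hT
  have Ups_nn : ∀ y, 0 ≤ Ups y := fun y => by
    unfold Ups; have := Real.add_one_le_exp y; linarith
  have Tnn : ∀ p, 0 ≤ T p := fun p =>
    mul_nonneg (mul_nonneg (mul_nonneg (g.nn _) (g.nn _)) (Real.exp_pos _).le) (Ups_nn _)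
  have sT : Summable T := by
    have s2 : Summable fun p : ℤ × ℤ => k p.1 * k p.2 :=
      g.sm.mul_of_nonneg g.sm g.nn g.nn
    refine Summable.of_nonneg_of_le Tnn (fun p => ?_)
      (s2.mul_right (Real.exp (2 * M) * (Real.exp (4 * M) + 4 * M)))
    simp only [hT]
    rw [mul_assoc]
    refine mul_le_mul_of_nonneg_left ?_ (mul_nonneg (g.nn _) (g.nn _))
    have b1 := hb x
    have b2 := hb (x + p.2)
    have b3 := hb (x + p.1)
    have b4 := hb (x + p.1 + p.2)
    refine mul_le_mul (Real.exp_le_exp.2 (by linarith)) ?_ (Ups_nn _) (Real.exp_pos _).le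
    unfold Ups
    have := Real.exp_le_exp.2 (show u (x + p.1 + p.2) - u (x + p.1) - u (x + p.2) + u x ≤ 4 * M by
      linarith)
    linarith
  have inj : Function.Injective (fun j : ℤ => ((j, -j) : ℤ × ℤ)) := by
    intro a b h; exact congrArg Prod.fst h
  have sW : Summable (fun j : ℤ => T (j, -j)) := sT.comp_injective inj
  have hW : ∑' j : ℤ, T (j, -j) ≤ ∑' p, T p :=
    tsum_comp_le_tsum_of_inj sT Tnn inj
  have HW := sW.hasSum
  have HW2 : HasSum (fun j : ℤ => T (-j, j)) (∑' j : ℤ, T (j, -j)) := by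
    have := (Equiv.neg ℤ).hasSum_iff.2 HW
    convert this using 1
    funext j; simp
  have HW3 := (HW.add HW2).mul_left (1 / 4)
  have HL := g.hasSum_lin hl H3.summable
  have key := hasSum_le (fun j => (tangent_k g hl j (X j)).trans (?_ :
    k j ^ 2 * Hfun (X j) ≤ 1 / 4 * (T (j, -j) + T (-j, j)))) HL HW3
  · rw [H3.tsum_eq, hSl] at key
    show Ef k l ≤ 1 / 2 * ∑' p, T p
    linarith
  · have e1 : u (x + j + -j) - u (x + j) - u (x + -j) + u x = 2 * X j := by
      simp only [X, add_neg_cancel_right, sub_eq_add_neg]; ring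
    have e2 : u (x + -j + j) - u (x + -j) - u (x + j) + u x = 2 * X j := by
      simp only [X, neg_add_cancel_right, sub_eq_add_neg]; ring
    simp only [hT, e1, e2, g.sy]
    unfold Hfun
    have e3 : 2 * Real.exp (-(X j)) ≤ Real.exp (u (x + -j) - u x) + Real.exp (u (x + j) - u x) := by
      have q : Real.exp (-(X j)) =
        Real.exp ((u (x + -j) - u x) / 2) * Real.exp ((u (x + j) - u x) / 2) := by
        rw [← Real.exp_add]; congr 1; simp only [X, sub_eq_add_neg]; ring
      have q1 : ∀ y : ℝ, Real.exp y = Real.exp (y / 2) ^ 2 := fun y => by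
        rw [← Real.exp_nat_mul]; congr 1; push_cast; ring
      rw [q, q1 (u (x + -j) - u x), q1 (u (x + j) - u x)]
      nlinarith [sq_nonneg (Real.exp ((u (x + -j) - u x) / 2) - Real.exp ((u (x + j) - u x) / 2))]
    have e4 := mul_le_mul_of_nonneg_left e3 (mul_nonneg (sq_nonneg (k j)) (Ups_nn (2 * X j)))
    nlinarith

lemma phi_asym {l m : ℝ} (hl : 1 ≤ l) (hm : l ≤ m) :
    Real.log (2 * m) - 1 / l ≤ phi m ∧ phi m ≤ Real.log (2 * m) + 1 / l := by
  have hl0 : 0 < l := by linarith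
  have hm0 : 0 < m := by linarith
  constructor
  · rw [← Real.exp_le_exp, sub_eq_add_neg, Real.exp_add, Real.exp_log (by linarith)]
    refine le_trans ?_ (le_exp_phi hm0.le)
    have h1 := Real.add_one_le_exp (1 / l)
    have h2 : Real.exp (1 / l) * Real.exp (-(1 / l)) = 1 := by rw [← Real.exp_add]; simp
    have h3 := Real.exp_pos (-(1 / l))
    have h4 : (1 / l + 1) * Real.exp (-(1 / l)) ≤ 1 := by nlinarith
    have h5 : (1 + l) * Real.exp (-(1 / l)) ≤ l := by
      calc _ = l * ((1 / l + 1) * Real.exp (-(1 / l))) := by field_simp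
        _ ≤ l * 1 := mul_le_mul_of_nonneg_left h4 hl0.le
        _ = l := mul_one l
    have h6 : (1 + l) * (2 * m * Real.exp (-(1 / l))) ≤ (1 + l) * (2 * m - 1) := by nlinarith
    exact le_of_mul_le_mul_left h6 (by linarith)
  · rw [← Real.exp_le_exp, Real.exp_add, Real.exp_log (by linarith)]
    refine (exp_phi_le hm0.le).trans ?_
    have h1 := Real.add_one_le_exp (1 / l)
    have h2 : 1 / m ≤ 1 / l := one_div_le_one_div_of_le hl0 hm
    have h3 : 2 * m * (1 / m + 1) ≤ 2 * m * Real.exp (1 / l) :=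
      mul_le_mul_of_nonneg_left (by linarith) (by linarith)
    have h4 : 2 * m * (1 / m + 1) = 2 + 2 * m := by field_simp; 
    linarith

lemma Good.S_asym {k : ℤ → ℝ} (g : Good k) (hM : Summable fun j => k j * Real.log (1 / k j))
    {l : ℝ} (hl : 1 ≤ l) :
    |Sf k l - (∑' j, k j * Real.log (1 / k j)) - (∑' j, k j) * Real.log (2 * l)| ≤
      (∑' j, k j) * (1 / l) := by
  have hl0 : 0 < l := by linarith
  have H1 := ((g.sphi l hl0.le).hasSum.sub hM.hasSum).sub (g.sm.hasSum.mul_right (Real.log (2 * l)))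
  have H2 := g.sm.hasSum.mul_right (1 / l)
  have H3 := g.sm.hasSum.mul_right (-(1 / l))
  have key : ∀ j, k j * (-(1 / l)) ≤
      k j * phi (l / k j) - k j * Real.log (1 / k j) - k j * Real.log (2 * l) ∧
      k j * phi (l / k j) - k j * Real.log (1 / k j) - k j * Real.log (2 * l) ≤ k j * (1 / l) := by
    intro j
    rcases (g.nn j).eq_or_lt with h | h
    · simp [← h]
    · have hm : l ≤ l / k j := by
        rw [le_div_iff₀ h]; have := g.le1 j; nlinarith
      have hlog : Real.log (2 * (l / k j)) = Real.log (1 / k j) + Real.log (2 * l) := by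
        rw [← Real.log_mul (by positivity) (by positivity)]; congr 1; field_simp
      obtain ⟨a, b⟩ := phi_asym hl hm
      rw [hlog] at a b
      constructor <;> nlinarith
  rw [abs_le]
  constructor
  · have := hasSum_le (fun j => (key j).1) H3 H1
    unfold Sf; linarith
  · exact hasSum_le (fun j => (key j).2) H1 H2

lemma Good.E_asym {k : ℤ → ℝ} (g : Good k) {l : ℝ} (hl : 0 ≤ l) :
    (∑' j, k j) * l - (∑' j, k j ^ 2) ≤ Ef k l ∧ Ef k l ≤ (∑' j, k j) * l := by
  have H1 := g.sm.hasSum.mul_right l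
  have H2 := g.ssq.hasSum
  have H3 := (g.sE hl).hasSum
  constructor
  · refine hasSum_le (fun j => ?_) (H1.sub H2) H3
    rw [H_eq_h, h_phi (div_nonneg hl (g.nn j))]
    have := two_x_exp (x := phi (l / k j))
    have h2 := ksq (k := k) l j
    nlinarith [sq_nonneg (k j)]
  · refine hasSum_le (fun j => ?_) H3 H1
    have h := H_le_h (phi_nonneg (l / k j))
    rw [h_phi (div_nonneg hl (g.nn j))] at h
    rw [mul_comm (k j), ← ksq]
    exact mul_le_mul_of_nonneg_left h (sq_nonneg _)

lemma Good.Kpos {k : ℤ → ℝ} (g : Good k) : 0 < ∑' j, k j := by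
  have := g.sm.le_tsum 1 (fun j _ => g.nn j)
  rw [g.one] at this; linarith

lemma Good.asym {k : ℤ → ℝ} (g : Good k) (hM : Summable fun j => k j * Real.log (1 / k j)) :
    Tendsto (fun r => Gf k r / (((∑' j : ℤ, k j) / 2) *
            Real.exp ((r - ∑' j : ℤ, k j * Real.log (1 / k j)) / (∑' j : ℤ, k j))))
        atTop (nhds 1) := by
  have hK := g.Kpos
  have hS := fun l hl => g.S_asym hM (l := l) hl
  have hE := fun l hl => g.E_asym (l := l) hl
  set K := ∑' j, k j
  set M := ∑' j : ℤ, k j * Real.log (1 / k j)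
  set C := ∑' j, k j ^ 2
  have hQ : Tendsto (fun l => Ef k l / ((K / 2) * Real.exp ((Sf k l - M) / K))) atTop (nhds 1) := by
    have t0 : Tendsto (fun l : ℝ => 1 / l) atTop (nhds 0) := by
      simpa using tendsto_inv_atTop_zero (𝕜 := ℝ)
    have tl : Tendsto (fun l : ℝ => (1 - C / K * (1 / l)) * Real.exp (-(1 / l))) atTop (nhds 1) := by
      have := ((tendsto_const_nhds (x := (1:ℝ))).sub (t0.const_mul (C / K))).mul
        (Real.continuous_exp.continuousAt.tendsto.comp t0.neg)
      simpa using this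
    have tu : Tendsto (fun l : ℝ => Real.exp (1 / l)) atTop (nhds 1) := by
      have := Real.continuous_exp.continuousAt.tendsto.comp t0
      simpa [Function.comp_def] using this
    refine tendsto_of_tendsto_of_tendsto_of_le_of_le' tl tu ?_ ?_
    · filter_upwards [eventually_ge_atTop 1, eventually_ge_atTop (C / K)] with l hl hlC
      have hl0 : 0 < l := by linarith
      have h1 := (abs_le.1 (hS l hl)).2
      have h2 : (Sf k l - M) / K ≤ Real.log (2 * l) + 1 / l := by
        rw [div_le_iff₀ hK]; linarith
      have h3 := Real.exp_le_exp.2 h2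
      rw [Real.exp_add, Real.exp_log (by linarith)] at h3
      have h4 := (hE l hl0.le).1
      rw [le_div_iff₀ (by positivity)]
      have h5 : 0 ≤ 1 - C / K * (1 / l) := by
        have : C / K * (1 / l) ≤ 1 := by
          rw [mul_one_div, div_le_one hl0]; exact hlC
        linarith
      have h6 : Real.exp (-(1 / l)) * Real.exp (1 / l) = 1 := by rw [← Real.exp_add]; simp
      calc (1 - C / K * (1 / l)) * Real.exp (-(1 / l)) * (K / 2 * Real.exp ((Sf k l - M) / K))
          ≤ (1 - C / K * (1 / l)) * Real.exp (-(1 / l)) * (K / 2 * (2 * l * Real.exp (1 / l))) := by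
            gcongr
        _ = (1 - C / K * (1 / l)) * K * l * (Real.exp (-(1 / l)) * Real.exp (1 / l)) := by ring
        _ = K * l - C := by rw [h6]; field_simp
        _ ≤ _ := h4
    · filter_upwards [eventually_ge_atTop 1] with l hl
      have hl0 : 0 < l := by linarith
      have h1 := (abs_le.1 (hS l hl)).1
      have h2 : Real.log (2 * l) + -(1 / l) ≤ (Sf k l - M) / K := by
        rw [le_div_iff₀ hK]; linarith
      have h3 := Real.exp_le_exp.2 h2
      rw [Real.exp_add, Real.exp_log (by linarith)] at h3
      have h4 := (hE l hl0.le).2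
      rw [div_le_iff₀ (by positivity)]
      have h6 : Real.exp (1 / l) * Real.exp (-(1 / l)) = 1 := by rw [← Real.exp_add]; simp
      calc Ef k l ≤ K * l := h4
        _ = Real.exp (1 / l) * (K / 2 * (2 * l * Real.exp (-(1 / l)))) := by
            linear_combination (-(K * l)) * h6
        _ ≤ _ := by gcongr
  refine (hQ.comp g.Lam_tendsto).congr' ?_
  filter_upwards [eventually_ge_atTop 0] with r hr
  simp only [Function.comp, g.S_Lam hr, Gf]

lemma int_hasSum_le {g : ℕ → ℝ} {a : ℝ} (hg : ∀ n, 0 ≤ g n) (h : HasSum g a) :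
    Summable (fun j : ℤ => g j.natAbs) ∧ ∑' j : ℤ, g j.natAbs ≤ 2 * a := by
  have s2 : Summable (fun n : ℕ => g (n + 1)) := (summable_nat_add_iff 1).2 h.summable
  have h1 : HasSum (fun n : ℕ => g (n : ℤ).natAbs) a := by simpa using h
  have h2 : HasSum (fun n : ℕ => g (-((n : ℤ) + 1)).natAbs) (∑' n, g (n + 1)) := by
    have e : ∀ n : ℕ, (-((n : ℤ) + 1)).natAbs = n + 1 := fun n => by omega
    simp only [e]
    exact s2.hasSum
  have h3 := HasSum.of_nat_of_neg_add_one (f := fun j : ℤ => g j.natAbs) h1 h2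
  refine ⟨h3.summable, ?_⟩
  rw [h3.tsum_eq]
  have h4 := h.summable.sum_add_tsum_nat_add 1
  rw [h.tsum_eq] at h4
  have := hg 0
  simp only [Finset.sum_range_one] at h4
  linarith

lemma block_hasSum {T : ℕ → ℝ} {A : ℝ} (hT : ∀ n, 0 ≤ T n) (h : HasSum T A) (N : ℕ) (hN : N ≠ 0) :
    HasSum (fun n : ℕ => T (n / N)) (A * N) := by
  have : NeZero N := ⟨hN⟩
  have h1 : HasSum (fun _ : Fin N => (1 : ℝ)) N := by
    have := hasSum_fintype (fun _ : Fin N => (1 : ℝ))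
    simpa using this
  have h2 := h.mul h1 (h.summable.mul_of_nonneg h1.summable hT (fun _ => zero_le_one))
  have h3 := (Nat.divModEquiv N).hasSum_iff.2 h2
  simpa [Function.comp_def] using h3

lemma kpow_eq {β : ℝ} (hβ : 0 < β) (j : ℤ) : kpow β j = |(j : ℝ)| ^ (-(1 + β)) := by
  unfold kpow
  split_ifs with h
  · subst h; simp; rw [Real.zero_rpow (by linarith)]
  · rfl

lemma kpow_pos (β : ℝ) {j : ℤ} (hj : j ≠ 0) : 0 < kpow β j := by
  unfold kpow; rw [if_neg hj]
  have : (j : ℝ) ≠ 0 := by exact_mod_cast hj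
  positivity

lemma kpow_mul {β : ℝ} (hβ : 0 < β) {l e : ℝ} (hl : 0 ≤ l) (j : ℤ) :
    kpow β j * (l / kpow β j) ^ e ≤ l ^ e * |(j : ℝ)| ^ (-((1 + β) * (1 - e))) := by
  by_cases hj : j = 0
  · have : kpow β j = 0 := by simp [kpow, hj]
    rw [this]; simp only [zero_mul]; positivity
  · have hp := kpow_pos β hj
    have hj' : 0 < |(j : ℝ)| := by
      have : (j : ℝ) ≠ 0 := by exact_mod_cast hj
      positivity
    rw [Real.div_rpow hl hp.le]
    have : |(j : ℝ)| ^ (-((1 + β) * (1 - e))) = kpow β j / kpow β j ^ e := by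
      have h1 := Real.rpow_sub hp 1 e
      rw [Real.rpow_one] at h1
      rw [← h1, kpow_eq hβ, ← Real.rpow_mul hj'.le]
      congr 1; ring
    rw [this]
    apply le_of_eq; ring

lemma kphi_le {β : ℝ} (hβ : 0 < β) {l e : ℝ} (he : 0 < e) (he1 : e ≤ 1) (hl : 0 ≤ l) (j : ℤ) :
    kpow β j * phi (l / kpow β j) ≤
      2 / e * (l ^ e * |(j : ℝ)| ^ (-((1 + β) * (1 - e)))) := by
  have hk : 0 ≤ kpow β j := by rw [kpow_eq hβ]; positivity
  have h1 := phi_le_rpow (div_nonneg hl hk) he he1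
  have h2 := mul_le_mul_of_nonneg_left h1 hk
  have h3 := mul_le_mul_of_nonneg_left (kpow_mul hβ (e := e) hl j) (show 0 ≤ 2 / e by positivity)
  linarith

lemma kpow_le_one {β : ℝ} (hβ : 0 < β) (j : ℤ) : kpow β j ≤ 1 := by
  unfold kpow; split_ifs with h
  · norm_num
  · apply Real.rpow_le_one_of_one_le_of_nonpos _ (by linarith)
    have := Int.one_le_abs h
    exact_mod_cast this

lemma kpow_good {β : ℝ} (hβ : 0 < β) {e : ℝ} (he : 0 < e) (he1 : e ≤ 1)
    (hs : 1 < (1 + β) * (1 - e)) : Good (kpow β) where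
  nn j := by rw [kpow_eq hβ]; positivity
  sy j := by simp [kpow_eq hβ]
  sm := by
    have := Real.summable_abs_int_rpow (b := 1 + β) (by linarith)
    exact this.congr fun j => (kpow_eq hβ j).symm
  le1 := kpow_le_one hβ
  one := by simp [kpow]
  sphi l hl := by
    refine Summable.of_nonneg_of_le (fun j => mul_nonneg ?_ (phi_nonneg _))
      (fun j => kphi_le hβ he he1 hl j)
      (((Real.summable_abs_int_rpow hs).mul_left _).mul_left _)
    rw [kpow_eq hβ]; positivity

lemma kpow_log {β : ℝ} (hβ : 0 < β) {e : ℝ} (he : 0 < e)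
    (hs : 1 < (1 + β) * (1 - e)) : Summable fun j => kpow β j * Real.log (1 / kpow β j) := by
  have nn : ∀ j, 0 ≤ kpow β j := fun j => by rw [kpow_eq hβ]; positivity
  refine Summable.of_nonneg_of_le (fun j => mul_nonneg (nn j) ?_) (fun j => ?_)
      (((Real.summable_abs_int_rpow hs).mul_left (1 ^ e)).mul_left (1 / e))
  · rw [one_div, Real.log_inv]
    have := Real.log_nonpos (nn j) (kpow_le_one hβ j)
    linarith
  · have h1 := Real.log_le_rpow_div (x := 1 / kpow β j) (one_div_nonneg.2 (nn j)) he
    have h2 := mul_le_mul_of_nonneg_left h1 (nn j)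
    have h3 := mul_le_mul_of_nonneg_left (kpow_mul hβ (l := 1) (e := e) zero_le_one j)
      (show 0 ≤ 1 / e by positivity)
    refine h2.trans (le_trans (le_of_eq ?_) h3)
    ring

lemma power_large {β : ℝ} (hβ : 0 < β) {e : ℝ} (he : 0 < e) (he1 : e ≤ 1)
    (hs : 1 < (1 + β) * (1 - e)) {p : ℝ} (hp : e * p = 1) :
    ∃ c, 0 < c ∧ ∀ l, 1 ≤ l → c * Sf (kpow β) l ^ p ≤ Ef (kpow β) l := by
  have g := kpow_good hβ he he1 hs
  have hp0 : 0 < p := by by_contra h; nlinarith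
  have hZ := Real.summable_abs_int_rpow hs
  set Z := ∑' j : ℤ, |(j : ℝ)| ^ (-((1 + β) * (1 - e))) with hZd
  have hZ1 : 1 ≤ Z := by
    have := hZ.le_tsum 1 (fun j _ => by positivity)
    simpa using this
  set B := 2 / e * Z with hB
  have hB0 : 0 < B := by positivity
  refine ⟨1 / (4 * B ^ p), by positivity, fun l hl => ?_⟩
  have hl0 : 0 ≤ l := by linarith
  have hS : Sf (kpow β) l ≤ B * l ^ e := by
    have := (g.sphi l hl0).tsum_le_tsum (fun j => kphi_le hβ he he1 hl0 j)
      ((hZ.mul_left _).mul_left _)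
    rw [tsum_mul_left, tsum_mul_left] at this
    refine this.trans (le_of_eq ?_)
    rw [hB]; ring
  have hS0 : 0 ≤ Sf (kpow β) l := (phi_nonneg _).trans (g.S_ge hl0)
  have hSp : Sf (kpow β) l ^ p ≤ B ^ p * l := by
    calc _ ≤ (B * l ^ e) ^ p := Real.rpow_le_rpow hS0 hS hp0.le
      _ = B ^ p * l := by
        rw [Real.mul_rpow hB0.le (by positivity), ← Real.rpow_mul hl0, hp, Real.rpow_one]
  have hE : l / 4 ≤ Ef (kpow β) l := by
    have h1 := (g.sE hl0).le_tsum 1 (fun j _ => mul_nonneg (sq_nonneg _) (Hfun_nonneg _))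
    have h2 := H_ge_lin (x := phi l) (by rw [h_phi hl0]; exact hl)
    rw [h_phi hl0] at h2
    simp only [g.one, one_pow, one_mul, div_one] at h1
    exact h2.trans h1
  refine le_trans ?_ hE
  rw [one_div, inv_mul_le_iff₀ (by positivity)]
  linarith

lemma power_small {β : ℝ} (hβ : 0 < β) {e : ℝ} (he : 0 < e) (he1 : e ≤ 1)
    (hs : 1 < (1 + β) * (1 - e)) {p : ℝ} (hp : p = (1 + 2 * β) / β) :
    ∃ c, 0 < c ∧ ∀ l, 0 < l → l ≤ 1 → c * Sf (kpow β) l ^ p ≤ Ef (kpow β) l := by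
  have g := kpow_good hβ he he1 hs
  have hp0 : 0 < p := by rw [hp]; positivity
  set s := (1 + β) * (1 - e) with hsd
  set T : ℕ → ℝ := fun q => if q = 0 then 1 else (q : ℝ) ^ (-s) with hTd
  have hT0 : ∀ n, 0 ≤ T n := fun n => by
    simp only [hTd]; split_ifs <;> positivity
  have sT : Summable T := by
    have h1 : Summable fun n : ℕ => (n : ℝ) ^ (-s) := Real.summable_nat_rpow.2 (by linarith)
    have h2 : Summable (fun n : ℕ => if n = 0 then (1 : ℝ) else 0) :=
      summable_of_ne_finset_zero (s := {0}) (fun n hn => by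
        have : n ≠ 0 := by simpa using hn
        simp [this])
    refine Summable.of_nonneg_of_le hT0 (fun n => ?_) (h2.add h1)
    simp only [hTd]
    split_ifs with h
    · have : (0:ℝ) ≤ (n : ℝ) ^ (-s) := by positivity
      linarith
    · simp
  set A := ∑' n, T n with hA
  have hA1 : 1 ≤ A := by
    have := sT.le_tsum 0 (fun j _ => hT0 j)
    simpa [hTd] using this
  set B := 2 / e * (4 * A) with hB
  have hB0 : 0 < B := by positivity
  refine ⟨1 / (54 * B ^ p), by positivity, fun l hl hl1 => ?_⟩
  set J := l ^ (-(1 / (1 + β))) with hJ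
  have hJ0 : 0 < J := by positivity
  have hJ1 : 1 ≤ J := by
    apply Real.one_le_rpow_of_pos_of_le_one_of_nonpos hl hl1
    have : 0 < 1 / (1 + β) := by positivity
    linarith
  have hJb : J ^ (1 + β) = l⁻¹ := by
    rw [hJ, ← Real.rpow_mul hl.le, ← Real.rpow_neg_one]; congr 1; field_simp
  have hJs : J ^ (-s) = l ^ (1 - e) := by
    rw [hJ, ← Real.rpow_mul hl.le]; congr 1; rw [hsd]; field_simp
  have hlJ : l * J = l ^ (β / (1 + β)) := by
    rw [hJ]; nth_rewrite 1 [← Real.rpow_one l]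
    rw [← Real.rpow_add hl]; congr 1; field_simp; ring
  have hllJ : l * (l * J) = l ^ ((1 + 2 * β) / (1 + β)) := by
    rw [hlJ]; nth_rewrite 1 [← Real.rpow_one l]
    rw [← Real.rpow_add hl]; congr 1; field_simp; ring
  set N := ⌈J⌉₊ with hN
  have hNJ : J ≤ N := Nat.le_ceil J
  have hN2 : (N : ℝ) ≤ 2 * J := by
    have := Nat.ceil_lt_add_one hJ0.le; linarith
  have hN0 : N ≠ 0 := by
    intro h; rw [h] at hNJ; simp at hNJ; linarith
  have hterm : ∀ j : ℤ, kpow β j * phi (l / kpow β j) ≤ 2 / e * l * T (j.natAbs / N) := by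
    intro j
    have h2e : 2 ≤ 2 / e := by rw [le_div_iff₀ he]; linarith
    by_cases hq : j.natAbs / N = 0
    · have : T (j.natAbs / N) = 1 := by simp [hTd, hq]
      rw [this, mul_one]
      have h1 := phi_le_two (div_nonneg hl.le (g.nn j))
      have h2 := mul_le_mul_of_nonneg_left h1 (g.nn j)
      have h3 : kpow β j * (2 * (l / kpow β j)) ≤ 2 * l := by
        by_cases hk : kpow β j = 0
        · rw [hk]; simp; exact hl.le
        · apply le_of_eq; field_simp
      have h4 := mul_le_mul_of_nonneg_right h2e hl.le
      linarith
    · set q := j.natAbs / N with hqd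
      have hq0 : 0 < (q : ℝ) := by exact_mod_cast Nat.pos_of_ne_zero hq
      have hT : T q = (q : ℝ) ^ (-s) := by simp [hTd, hq]
      have h1 : (q : ℝ) * J ≤ |(j : ℝ)| := by
        have h := Nat.div_mul_le_self j.natAbs N
        have h' : ((q * N : ℕ) : ℝ) ≤ (j.natAbs : ℝ) := by exact_mod_cast h
        rw [Nat.cast_natAbs] at h'
        push_cast at h'
        exact (mul_le_mul_of_nonneg_left hNJ hq0.le).trans h'
      have h2 : |(j : ℝ)| ^ (-s) ≤ ((q : ℝ) * J) ^ (-s) :=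
        Real.rpow_le_rpow_of_nonpos (by positivity) h1 (by linarith)
      rw [Real.mul_rpow hq0.le hJ0.le, hJs] at h2
      have h3 := kphi_le hβ he he1 hl.le j
      rw [hT]
      have h5 : l ^ e * l ^ (1 - e) = l := by
        rw [← Real.rpow_add hl]; simp
      calc _ ≤ 2 / e * (l ^ e * |(j : ℝ)| ^ (-s)) := h3
        _ ≤ 2 / e * (l ^ e * ((q : ℝ) ^ (-s) * l ^ (1 - e))) := by gcongr
        _ = 2 / e * (l ^ e * l ^ (1 - e)) * (q : ℝ) ^ (-s) := by ring
        _ = _ := by rw [h5]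
  obtain ⟨sb, hb⟩ := int_hasSum_le (fun n => hT0 _) (block_hasSum hT0 sT.hasSum N hN0)
  have hS : Sf (kpow β) l ≤ B * l ^ (β / (1 + β)) := by
    have := (g.sphi l hl.le).tsum_le_tsum hterm (sb.mul_left _)
    rw [tsum_mul_left] at this
    calc Sf (kpow β) l ≤ _ := this
      _ ≤ 2 / e * l * (2 * (A * N)) := by gcongr
      _ ≤ 2 / e * l * (2 * (A * (2 * J))) := by gcongr
      _ = B * (l * J) := by rw [hB]; ring
      _ = _ := by rw [hlJ]
  have hS0 : 0 ≤ Sf (kpow β) l := (phi_nonneg _).trans (g.S_ge hl.le)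
  have hSp : Sf (kpow β) l ^ p ≤ B ^ p * l ^ ((1 + 2 * β) / (1 + β)) := by
    calc _ ≤ (B * l ^ (β / (1 + β))) ^ p := Real.rpow_le_rpow hS0 hS hp0.le
      _ = _ := by
        rw [Real.mul_rpow hB0.le (by positivity), ← Real.rpow_mul hl.le]
        congr 2; rw [hp]; field_simp
  have hE : l ^ ((1 + 2 * β) / (1 + β)) / 54 ≤ Ef (kpow β) l := by
    rw [← hllJ]
    set n := ⌊J⌋₊ with hn
    have hn1 : J ≤ 2 * n := by
      have h1 := Nat.lt_floor_add_one J
      have h2 : 1 ≤ n := Nat.le_floor (by simpa using hJ1)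
      have h3 : (1 : ℝ) ≤ n := by exact_mod_cast h2
      linarith
    have h1 := (g.sE hl.le).sum_le_tsum (Finset.Icc (1 : ℤ) n)
      (fun j _ => mul_nonneg (sq_nonneg _) (Hfun_nonneg _))
    have h2 : ∀ j ∈ Finset.Icc (1 : ℤ) n, l ^ 2 / 27 ≤
        kpow β j ^ 2 * Hfun (phi (l / kpow β j)) := by
      intro j hj
      rw [Finset.mem_Icc] at hj
      have hj0 : j ≠ 0 := by omega
      have hk := kpow_pos β hj0
      have hjr : (0 : ℝ) < j := by exact_mod_cast (by omega : 0 < j)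
      have hjJ : (j : ℝ) ≤ J := by
        have h1 : (j : ℝ) ≤ n := by exact_mod_cast hj.2
        exact h1.trans (Nat.floor_le hJ0.le)
      have hlk : l ≤ kpow β j := by
        rw [kpow_eq hβ, abs_of_pos hjr, Real.rpow_neg hjr.le]
        rw [le_inv_comm₀ hl (by positivity), ← hJb]
        exact Real.rpow_le_rpow hjr.le hjJ (by linarith)
      have hm : 0 ≤ l / kpow β j := by positivity
      have h3 := H_ge_sq (phi_nonneg (l / kpow β j)) (by
        rw [h_phi hm, div_le_one hk]; exact hlk)
      rw [h_phi hm] at h3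
      have h4 := mul_le_mul_of_nonneg_left h3 (sq_nonneg (kpow β j))
      refine le_trans (le_of_eq ?_) h4
      field_simp
    have h3 := Finset.card_nsmul_le_sum _ _ _ h2
    rw [Int.card_Icc, nsmul_eq_mul] at h3
    have h4 : (((n : ℤ) + 1 - 1).toNat : ℝ) = n := by simp
    rw [h4] at h3
    have h5 : l * (l * J) / 54 ≤ n * (l ^ 2 / 27) := by
      nlinarith [mul_le_mul_of_nonneg_left hn1 (sq_nonneg l)]
    exact h5.trans (h3.trans h1)
  refine le_trans ?_ hE
  rw [one_div, inv_mul_le_iff₀ (by positivity)]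
  linarith

/-- Corollary (power-type kernel): for `β > 0` the operator `L_β` satisfies `CD_Υ(0,G_β)` with
a strictly convex CD-function `G_β` such that
`G_β(r) ∼ (|k_β|₁/2) e^{(r − M(k_β))/|k_β|₁}` as `r → ∞` and `G_β(r) ≥ c r^{(1+2β)/β}`
for all `r ≥ 0`, for some `c > 0`. -/
theorem powertype_CD (β : ℝ) (hβ : 0 < β) :
    ∃ G : ℝ → ℝ, IsCDFunction G ∧ StrictConvexOn ℝ (Ici 0) G ∧ CDUps (kpow β) G ∧
      Tendsto (fun r => G r /
          (((∑' j : ℤ, kpow β j) / 2) *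
            Real.exp ((r - ∑' j : ℤ, kpow β j * Real.log (1 / kpow β j)) /
              (∑' j : ℤ, kpow β j))))
        atTop (nhds 1) ∧
      ∃ c : ℝ, 0 < c ∧ ∀ r : ℝ, 0 ≤ r → c * r ^ ((1 + 2 * β) / β) ≤ G r := by

  set e := β / (1 + 2 * β) with he
  set p := (1 + 2 * β) / β with hp
  have he0 : 0 < e := by positivity
  have he1 : e ≤ 1 := by rw [he, div_le_one (by positivity)]; linarith
  have hs : 1 < (1 + β) * (1 - e) := by
    have : (1 + β) * (1 - e) = 1 + β ^ 2 / (1 + 2 * β) := by rw [he]; field_simp; ring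
    rw [this]
    have : 0 < β ^ 2 / (1 + 2 * β) := by positivity
    linarith
  have hep : e * p = 1 := by rw [he, hp]; field_simp
  have hp2 : 2 < p := by rw [hp, lt_div_iff₀ hβ]; linarith
  have g := kpow_good hβ he0 he1 hs
  obtain ⟨c1, hc1, H1⟩ := power_large hβ he0 he1 hs hep
  obtain ⟨c2, hc2, H2⟩ := power_small hβ he0 he1 hs hp
  have hc : 0 < min c1 c2 := lt_min hc1 hc2
  have hpow : ∀ r : ℝ, 0 ≤ r → min c1 c2 * r ^ p ≤ Gf (kpow β) r := by
    intro r hr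
    have hS := g.S_Lam hr
    have hrp : 0 ≤ r ^ p := by positivity
    rcases (Lam_nonneg (kpow β) r).eq_or_lt with h | h
    · rw [← h, Sf_zero] at hS
      rw [← hS, Real.zero_rpow (by linarith), mul_zero]; exact Gf_nonneg _ _
    · rcases le_total (Lam (kpow β) r) 1 with h1 | h1
      · have := H2 _ h h1
        rw [hS] at this
        exact (mul_le_mul_of_nonneg_right (min_le_right _ _) hrp).trans this
      · have := H1 _ h1
        rw [hS] at this
        exact (mul_le_mul_of_nonneg_right (min_le_left _ _) hrp).trans this
  refine ⟨Gf (kpow β), ⟨g.G_cont, fun r _ => Gf_nonneg _ r, g.G_zero, g.G_div, 1, one_pos, ?_⟩,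
    g.G_sconv, g.CD, g.asym (kpow_log hβ he0 hs), min c1 c2, hc, hpow⟩
  have hpos : ∀ r ∈ Ici (1 : ℝ), 0 < Gf (kpow β) r := fun r hr => by
    have hr : 1 ≤ r := hr
    have : 0 < r := by linarith
    exact lt_of_lt_of_le (by positivity) (hpow r this.le)
  have hcont : ContinuousOn (fun r => 1 / Gf (kpow β) r) (Ici 1) :=
    continuousOn_const.div (g.G_cont.mono (Ici_subset_Ici.2 zero_le_one))
      (fun r hr => (hpos r hr).ne')
  have hint : MeasureTheory.IntegrableOn (fun r : ℝ => (1 / min c1 c2) * r ^ (-p)) (Ici 1) := by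
    rw [integrableOn_Ici_iff_integrableOn_Ioi]
    exact (integrableOn_Ioi_rpow_of_lt (by linarith) one_pos).const_mul _
  refine MeasureTheory.Integrable.mono' hint
    (hcont.aestronglyMeasurable measurableSet_Ici) ?_
  rw [MeasureTheory.ae_restrict_iff' measurableSet_Ici]
  refine Eventually.of_forall fun r hr => ?_
  have hr1 : 1 ≤ r := hr
  have hr0 : 0 < r := by linarith
  rw [Real.norm_of_nonneg (one_div_nonneg.2 (hpos r hr).le), Real.rpow_neg hr0.le,
    one_div_mul_eq_div, ← one_div, div_div]
  rw [mul_comm (r ^ p)]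
  exact one_div_le_one_div_of_le (by positivity) (hpow r hr0.le)
end
end
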